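/- arXiv:1602.02976 — 2 statements merged into one kernel-verified Lean document; each statement's English description precedes it below -/
import Mathlib

section
/- Let n ≥ 2 and let f ∈ ℂ[x₁,…,xₙ] be a non-constant polynomial with f(0) = 0 which is convenient and non-degenerate at 0, and such that V = {f = 0} has an isolated singular point at 0. With the deformation setup (P, l, σ_y f, V_y, Ω) fixed, let Ṽ := {(x,y) ∈ ℂⁿ × ℂ^l : σ_y f(x) = 0}. For every open subset U ⊆ Ω whose closure is compact and contained in Ω and which is contractible, there exists ε₀ > 0 such that for every ε with 0 < ε ≤ ε₀ and every point y ∈ U, the space Ṽ ∩ ((B(0,ε) ∖ {0}) × U) is homotopy equivalent to the space V_y ∩ S(0,ε), where B(0,ε) is the open ball and S(0,ε) the sphere of radius ε centered at 0 in ℂⁿ, all spaces carrying the subspace topologies. -/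
open MvPolynomial

noncomputable section

/-- The exponent vector of a monomial, regarded as a point of `ℝⁿ`. -/
def expR {n : ℕ} (α : Fin n →₀ ℕ) : Fin n → ℝ := fun i => (α i : ℝ)

/-- The convex hull of the union, over `α ∈ s`, of the translates `α + ℝ₊ⁿ` of the
nonnegative orthant. -/
def newtonRegion {n : ℕ} (s : Set (Fin n →₀ ℕ)) : Set (Fin n → ℝ) :=
  convexHull ℝ {x | ∃ α ∈ s, ∃ r : Fin n → ℝ, (∀ i, 0 ≤ r i) ∧ x = expR α + r}

/-- The Newton polyhedron `Γ₊(f)` of `f` at the origin. -/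
def NewtonPolyhedron {n : ℕ} (f : MvPolynomial (Fin n) ℂ) : Set (Fin n → ℝ) :=
  newtonRegion {α | α ∈ f.support}

/-- The union of all bounded (nonempty, exposed) faces of `A`. -/
def boundedFacesUnion {n : ℕ} (A : Set (Fin n → ℝ)) : Set (Fin n → ℝ) :=
  {x | ∃ F : Set (Fin n → ℝ), F.Nonempty ∧ IsExposed ℝ A F ∧
    Bornology.IsBounded F ∧ x ∈ F}

/-- The Newton boundary `Γ_f` of `f`: the union of the bounded faces of `Γ₊(f)`. -/
def NewtonBoundary {n : ℕ} (f : MvPolynomial (Fin n) ℂ) : Set (Fin n → ℝ) :=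
  boundedFacesUnion (NewtonPolyhedron f)

/-- `f` is convenient: `Γ₊(f)` meets the positive part of every coordinate axis. -/
def Convenient {n : ℕ} (f : MvPolynomial (Fin n) ℂ) : Prop :=
  ∀ i : Fin n, ∃ t : ℝ, 0 < t ∧ Pi.single i t ∈ NewtonPolyhedron f

open Classical in
/-- The part `f_F` of `f` supported on a subset `F ⊆ ℝⁿ`. -/
def faceRestrict {n : ℕ} (f : MvPolynomial (Fin n) ℂ) (F : Set (Fin n → ℝ)) :
    MvPolynomial (Fin n) ℂ :=
  ∑ α ∈ f.support.filter (fun α => expR α ∈ F), monomial α (f.coeff α)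

/-- The system `g = ∂g/∂x₁ = ⋯ = ∂g/∂xₙ = 0` has a solution in `(ℂ ∖ {0})ⁿ`. -/
def hasTorusSolution {n : ℕ} (g : MvPolynomial (Fin n) ℂ) : Prop :=
  ∃ x : Fin n → ℂ, (∀ i, x i ≠ 0) ∧ eval x g = 0 ∧ ∀ i, eval x (pderiv i g) = 0

/-- `f` is non-degenerate at `0`: for every bounded face `F` of `Γ₊(f)` the system
`f_F = ∂f_F/∂x₁ = ⋯ = ∂f_F/∂xₙ = 0` has no solution in the torus. -/
def NondegAtZero {n : ℕ} (f : MvPolynomial (Fin n) ℂ) : Prop :=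
  ∀ F : Set (Fin n → ℝ), F.Nonempty → IsExposed ℝ (NewtonPolyhedron f) F →
    Bornology.IsBounded F → ¬ hasTorusSolution (faceRestrict f F)

/-- `x` is a singular point of the hypersurface `{h = 0} ⊆ ℂⁿ`. -/
def IsSingularPt {n : ℕ} (h : MvPolynomial (Fin n) ℂ) (x : Fin n → ℂ) : Prop :=
  eval x h = 0 ∧ ∀ i, eval x (pderiv i h) = 0

/-- The deformed polynomial `σ_y f = Σ_α (a_α + y_α) x^α`. -/
def perturb {n : ℕ} (f : MvPolynomial (Fin n) ℂ) (S : Finset (Fin n →₀ ℕ))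
    (y : {α // α ∈ S} → ℂ) : MvPolynomial (Fin n) ℂ :=
  f + ∑ α ∈ S.attach, monomial α.1 (y α)

/-- The parameter set `Ω ⊆ ℂ^{P ∩ ℤⁿ}`. -/
def Omega {n : ℕ} (f : MvPolynomial (Fin n) ℂ) (S : Finset (Fin n →₀ ℕ)) :
    Set ({α // α ∈ S} → ℂ) :=
  {y | NewtonBoundary (perturb f S y) = NewtonBoundary f ∧ NondegAtZero (perturb f S y)}

/-- The open Euclidean ball of radius `ε` centered at `0` in `ℂⁿ`. -/
def eBall (n : ℕ) (ε : ℝ) : Set (Fin n → ℂ) := {x | ∑ i, ‖x i‖ ^ 2 < ε ^ 2}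

/-- The Euclidean sphere of radius `ε` centered at `0` in `ℂⁿ`. -/
def eSphere (n : ℕ) (ε : ℝ) : Set (Fin n → ℂ) := {x | ∑ i, ‖x i‖ ^ 2 = ε ^ 2}

/-- The total deformed hypersurface `Ṽ = {(x,y) | σ_y f(x) = 0} ⊆ ℂⁿ × ℂ^l`. -/
def Vtilde {n : ℕ} (f : MvPolynomial (Fin n) ℂ) (S : Finset (Fin n →₀ ℕ)) :
    Set ((Fin n → ℂ) × ({α // α ∈ S} → ℂ)) :=
  {p | eval p.1 (perturb f S p.2) = 0}

open Set Filter Topology unitInterval in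
theorem exists_continuous_step {X B : Type*} [TopologicalSpace X]
    [TopologicalSpace.MetrizableSpace X]
    [TopologicalSpace B] {W : Set (B × B)} (hW : IsOpen W) (hdiag : ∀ b, (b, b) ∈ W)
    {H : X × I → B} (hH : Continuous H) :
    ∃ δ : C(X, ℝ), ∀ x, 0 < δ x ∧ ∀ s t : I, dist s t ≤ δ x → (H (x, s), H (x, t)) ∈ W := by
  let _ := TopologicalSpace.metrizableSpaceMetric X
  refine exists_continuous_forall_mem_convex_of_local_const
    (t := fun x => {d : ℝ | 0 < d ∧ ∀ s t : I, dist s t ≤ d → (H (x, s), H (x, t)) ∈ W}) ?_ ?_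
  · intro x
    refine Set.OrdConnected.convex ⟨?_⟩
    intro a ha b hb c hc
    exact ⟨ha.1.trans_le hc.1, fun s t h => hb.2 s t (h.trans hc.2)⟩
  · intro x
    set O : Set (X × (I × I)) := {q | (H (q.1, q.2.1), H (q.1, q.2.2)) ∈ W}
    have hO : IsOpen O := hW.preimage (by fun_prop)
    have hd : IsCompact (Set.diagonal I) := isCompact_diagonal
    obtain ⟨u, v, hu, hv, hxu, hdv, huv⟩ := generalized_tube_lemma (isCompact_singleton (x := x))
      hd hO (by
        rintro ⟨x', s, t⟩ ⟨-, hst⟩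
        have : s = t := hst
        subst this
        exact hdiag _)
    have hvU : v ∈ uniformity I := by
      rw [← nhdsSet_diagonal_eq_uniformity]
      exact hv.mem_nhdsSet.mpr hdv
    obtain ⟨e, he, hev⟩ := Metric.mem_uniformity_dist.mp hvU
    refine ⟨e / 2, ?_⟩
    filter_upwards [hu.mem_nhds (hxu rfl)] with x' hx'
    refine ⟨by positivity, fun s t hst => ?_⟩
    exact huv (Set.mk_mem_prod hx' (hev (by linarith)))

open Set Filter Topology unitInterval in
/-- Homotopy lifting for maps admitting a continuous local transport of fibres. -/
theorem exists_homotopy_lift {X E B : Type*} [TopologicalSpace X]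
    [TopologicalSpace.MetrizableSpace X] [TopologicalSpace E] [TopologicalSpace B]
    {p : E → B} {W : Set (B × B)} (hW : IsOpen W) (hdiag : ∀ b, (b, b) ∈ W)
    {τ : E × B → E} (hτ : ContinuousOn τ {q | (p q.1, q.2) ∈ W})
    (hpτ : ∀ q : E × B, (p q.1, q.2) ∈ W → p (τ q) = q.2) (hτp : ∀ e, τ (e, p e) = e)
    {g : X → E} (hg : Continuous g) {H : X × I → B} (hH : Continuous H)
    (h0 : ∀ x, H (x, 0) = p (g x)) :
    ∃ G : X × I → E, Continuous G ∧ (∀ x, G (x, 0) = g x) ∧ ∀ q, p (G q) = H q := by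
  obtain ⟨δ, hδ⟩ := exists_continuous_step hW hdiag hH
  let m : ℕ → X × I → I := fun k q => projIcc 0 1 zero_le_one (min (q.2 : ℝ) (k * δ q.1))
  have hm : ∀ k, Continuous (m k) := fun k => continuous_projIcc.comp (by fun_prop)
  have hmval : ∀ k q, (m k q : ℝ) = min (q.2 : ℝ) (k * δ q.1) := by
    intro k q
    have h1 : 0 ≤ min (q.2 : ℝ) (k * δ q.1) :=
      le_min q.2.2.1 (mul_nonneg (Nat.cast_nonneg _) (hδ q.1).1.le)
    have h2 : min (q.2 : ℝ) (k * δ q.1) ≤ 1 := (min_le_left _ _).trans q.2.2.2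
    simp only [m]
    rw [projIcc_of_mem _ ⟨h1, h2⟩]
  have hm0 : ∀ q, m 0 q = 0 := by
    intro q
    apply Subtype.ext
    rw [hmval]
    simpa using q.2.2.1
  have hmdist : ∀ k q, dist (m k q) (m (k + 1) q) ≤ δ q.1 := by
    intro k q
    have hp := (hδ q.1).1
    rw [Subtype.dist_eq, hmval, hmval, Real.dist_eq, abs_le]
    push_cast
    constructor
    · rcases le_total (q.2 : ℝ) (k * δ q.1) with h | h <;>
      rcases le_total (q.2 : ℝ) ((k + 1) * δ q.1) with h' | h' <;>
      simp only [min_eq_left, min_eq_right, h, h'] <;> nlinarith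
    · rcases le_total (q.2 : ℝ) (k * δ q.1) with h | h <;>
      rcases le_total (q.2 : ℝ) ((k + 1) * δ q.1) with h' | h' <;>
      simp only [min_eq_left, min_eq_right, h, h'] <;> nlinarith
  let L : ℕ → X × I → E := fun k => Nat.rec (fun q => g q.1)
    (fun k Lk q => τ (Lk q, H (q.1, m (k + 1) q))) k
  have hL0 : ∀ q, L 0 q = g q.1 := fun q => rfl
  have hLs : ∀ k q, L (k + 1) q = τ (L k q, H (q.1, m (k + 1) q)) := fun k q => rfl
  have key : ∀ k, Continuous (L k) ∧ ∀ q, p (L k q) = H (q.1, m k q) := by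
    intro k
    induction k with
    | zero =>
      refine ⟨hg.comp continuous_fst, fun q => ?_⟩
      rw [hm0, h0, hL0]
    | succ k ih =>
      have hmem : ∀ q, (p (L k q), H (q.1, m (k + 1) q)) ∈ W := by
        intro q
        rw [ih.2]
        exact (hδ q.1).2 _ _ (hmdist k q)
      refine ⟨?_, fun q => ?_⟩
      · have : Continuous fun q : X × I => (L k q, H (q.1, m (k + 1) q)) :=
          ih.1.prodMk (hH.comp (continuous_fst.prodMk (hm _)))
        exact hτ.comp_continuous this hmem
      · rw [hLs]
        exact hpτ _ (hmem q)
  have hstep : ∀ (k : ℕ) q, (q.2 : ℝ) ≤ k * δ q.1 → L (k + 1) q = L k q := by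
    intro k q hq
    have hp := (hδ q.1).1
    have : m (k + 1) q = m k q := by
      apply Subtype.ext
      rw [hmval, hmval, min_eq_left hq, min_eq_left]
      push_cast
      nlinarith
    rw [hLs, this, ← (key k).2, hτp]
  have hstab : ∀ (k : ℕ) q, (q.2 : ℝ) ≤ k * δ q.1 → ∀ j : ℕ, k ≤ j → L j q = L k q := by
    intro k q hq j hj
    induction j, hj using Nat.le_induction with
    | base => rfl
    | succ j hj ih =>
      rw [hstep j q, ih]
      refine hq.trans (mul_le_mul_of_nonneg_right (by exact_mod_cast hj) (hδ q.1).1.le)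
  let N : X → ℕ := fun x => ⌈1 / δ x⌉₊
  have hN : ∀ x, 1 ≤ N x * δ x := by
    intro x
    have := Nat.le_ceil (1 / δ x)
    rwa [div_le_iff₀ (hδ x).1] at this
  have hNq : ∀ q : X × I, (q.2 : ℝ) ≤ N q.1 * δ q.1 := fun q => q.2.2.2.trans (hN q.1)
  refine ⟨fun q => L (N q.1) q, ?_, fun x => ?_, fun q => ?_⟩
  · rw [continuous_iff_continuousAt]
    intro q
    obtain ⟨K, hK⟩ := exists_nat_gt (1 / δ q.1)
    have hK' : ∀ᶠ q' in 𝓝 q, 1 < K * δ q'.1 := by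
      have : 1 < K * δ q.1 := by rwa [div_lt_iff₀ (hδ q.1).1] at hK
      have hc : Continuous fun q' : X × I => (K : ℝ) * δ q'.1 := by fun_prop
      exact hc.continuousAt.eventually (lt_mem_nhds this)
    refine ((key K).1.continuousAt (x := q)).congr ?_
    filter_upwards [hK'] with q' hq'
    have h1 : (q'.2 : ℝ) ≤ K * δ q'.1 := q'.2.2.2.trans hq'.le
    rcases le_total K (N q'.1) with h | h
    · exact (hstab K q' h1 _ h).symm
    · exact hstab _ q' (hNq q') _ h
  · have h := hstab 0 (x, 0) (by simp) (N x) (Nat.zero_le _)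
    exact h
  · have : m (N q.1) q = q.2 := by
      apply Subtype.ext
      rw [hmval, min_eq_left (hNq q)]
    show p (L (N q.1) q) = H q
    rw [(key _).2, this]

open Set Filter Topology unitInterval in
/-- Over a contractible base, a map with a continuous local transport of fibres is homotopy
equivalent to each of its fibres. -/
theorem homotopyEquiv_fiber {E B : Type*} [TopologicalSpace E]
    [TopologicalSpace.MetrizableSpace E] [TopologicalSpace B] [ContractibleSpace B]
    {p : E → B} (hp : Continuous p) {W : Set (B × B)} (hW : IsOpen W) (hdiag : ∀ b, (b, b) ∈ W)
    {τ : E × B → E} (hτ : ContinuousOn τ {q | (p q.1, q.2) ∈ W})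
    (hpτ : ∀ q : E × B, (p q.1, q.2) ∈ W → p (τ q) = q.2) (hτp : ∀ e, τ (e, p e) = e) (b₀ : B) :
    Nonempty (ContinuousMap.HomotopyEquiv E {e : E // p e = b₀}) := by
  obtain ⟨b₁, ⟨K⟩⟩ := id_nullhomotopic B
  obtain ⟨γ⟩ : Joined b₁ b₀ := PathConnectedSpace.joined b₁ b₀
  obtain ⟨K⟩ : ContinuousMap.Homotopic (ContinuousMap.id B) (ContinuousMap.const B b₀) := by
    refine ContinuousMap.Homotopic.trans ⟨K⟩ ⟨⟨⟨fun q => γ q.1, by fun_prop⟩, ?_, ?_⟩⟩ <;>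
    intro x <;> simp
  obtain ⟨G, hGc, hG0, hGp⟩ := exists_homotopy_lift hW hdiag hτ hpτ hτp (g := fun e : E => e)
    continuous_id (H := fun q : E × I => K (q.2, p q.1)) (by fun_prop) (by intro x; simp)
  let r : C(E, {e : E // p e = b₀}) := ⟨fun e => ⟨G (e, 1), by rw [hGp]; simp⟩, by fun_prop⟩
  let i : C({e : E // p e = b₀}, E) := ⟨Subtype.val, continuous_subtype_val⟩
  let ℓ : Path b₀ b₀ := K.evalAt b₀
  obtain ⟨Q⟩ : Path.Homotopic ℓ (Path.refl b₀) := SimplyConnectedSpace.paths_homotopic _ _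
  have : TopologicalSpace.MetrizableSpace {e : E // p e = b₀} :=
    Topology.IsEmbedding.subtypeVal.metrizableSpace
  have : TopologicalSpace.MetrizableSpace I := inferInstance
  have : TopologicalSpace.MetrizableSpace ({e : E // p e = b₀} × I) := inferInstance
  obtain ⟨Γ, hΓc, hΓ0, hΓp⟩ := exists_homotopy_lift hW hdiag hτ hpτ hτp
    (X := {e : E // p e = b₀} × I) (g := fun q : {e : E // p e = b₀} × I => G (q.1.1, q.2))
    (by fun_prop)
    (H := fun q : ({e : E // p e = b₀} × I) × I => Q (q.2, q.1.2)) (by fun_prop) (by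
      rintro ⟨⟨e, he⟩, t⟩
      rw [hGp]
      simp only [ContinuousMap.HomotopyWith.apply_zero]
      simp [ℓ, he, ContinuousMap.Homotopy.evalAt])
  refine ⟨⟨r, i, ?_, ?_⟩⟩
  · refine ContinuousMap.Homotopic.symm ⟨⟨⟨fun q => G (q.2, q.1), by fun_prop⟩, ?_, ?_⟩⟩
    · intro e; simp [hG0]
    · intro e; simp [r, i]
  · have a1 : ContinuousMap.Homotopic (ContinuousMap.id {e : E // p e = b₀})
        ⟨fun e : {e : E // p e = b₀} => (⟨Γ ((e, 0), 1), by rw [hΓp]; simp⟩ :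
          {e : E // p e = b₀}), by fun_prop⟩ := by
      refine ⟨⟨⟨fun q => ⟨Γ ((q.2, 0), q.1), by rw [hΓp]; simp⟩, by fun_prop⟩, ?_, ?_⟩⟩
      · intro e; apply Subtype.ext; simp [hΓ0, hG0]
      · intro e; rfl
    have a2 : ContinuousMap.Homotopic
        (⟨fun e : {e : E // p e = b₀} => (⟨Γ ((e, 0), 1), by rw [hΓp]; simp⟩ :
          {e : E // p e = b₀}), by fun_prop⟩
          : C({e : E // p e = b₀}, {e : E // p e = b₀}))
        ⟨fun e : {e : E // p e = b₀} => (⟨Γ ((e, 1), 1), by rw [hΓp]; simp⟩ :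
          {e : E // p e = b₀}), by fun_prop⟩ := by
      refine ⟨⟨⟨fun q => ⟨Γ ((q.2, q.1), 1), by rw [hΓp]; simp⟩, by fun_prop⟩, ?_, ?_⟩⟩
      · intro e; rfl
      · intro e; rfl
    have a3 : ContinuousMap.Homotopic (r.comp i)
        ⟨fun e : {e : E // p e = b₀} => (⟨Γ ((e, 1), 1), by rw [hΓp]; simp⟩ :
          {e : E // p e = b₀}), by fun_prop⟩ := by
      refine ⟨⟨⟨fun q => ⟨Γ ((q.2, 1), q.1), by rw [hΓp]; simp⟩, by fun_prop⟩, ?_, ?_⟩⟩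
      · intro e; apply Subtype.ext; simp [hΓ0, r, i]
      · intro e; rfl
    exact a3.trans (a1.trans a2).symm

open Filter Topology in
theorem exists_minimal_correction {X M Y : Type*} [NormedAddCommGroup X] [NormedSpace ℝ X]
    [FiniteDimensional ℝ X] [NormedAddCommGroup M] [NormedSpace ℝ M] [FiniteDimensional ℝ M]
    [NormedAddCommGroup Y] [NormedSpace ℝ Y] [FiniteDimensional ℝ Y]
    {Z : Set (X × M)} {g : X × M → Y} (hg : ContDiff ℝ 1 g)
    {ν : X × M → Y →L[ℝ] X} (hν : ContDiff ℝ 1 ν) (hZ : ∀ q ∈ Z, g q = 0)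
    (hinj : ∀ q ∈ Z, ∀ c, fderiv ℝ (fun x => g (x, q.2)) q.1 (ν q c) = 0 → c = 0) :
    ∃ cm : X × M × M → Y, ∀ q ∈ Z, cm (q.1, q.2, q.2) = 0 ∧
      ∀ᶠ z in 𝓝 (q.1, q.2, q.2), ContinuousAt cm z ∧
        g (z.1 + ν (z.1, z.2.1) (cm z), z.2.2) = 0 := by
  classical
  have := FiniteDimensional.complete ℝ X
  have := FiniteDimensional.complete ℝ Y
  have := FiniteDimensional.complete ℝ M
  let Φ : (X × M × M) × Y → Y := fun w => g (w.1.1 + ν (w.1.1, w.1.2.1) w.2, w.1.2.2)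
  have hΦ : ContDiff ℝ 1 Φ := by
    refine hg.comp (ContDiff.prodMk (ContDiff.add (by fun_prop) (ContDiff.clm_apply ?_ ?_)) ?_)
    · exact hν.comp (by fun_prop)
    · fun_prop
    · fun_prop
  let Q : X × M × M → Y → Prop := fun z c =>
    Φ (z, c) = 0 ∧ ∀ c', Φ (z, c') = 0 → c' ≠ c → ‖c‖ < ‖c'‖
  have hQ : ∀ z c c', Q z c → Q z c' → c = c' := by
    intro z c c' h h'
    by_contra hne
    exact lt_asymm (h.2 c' h'.1 (Ne.symm hne)) (h'.2 c h.1 hne)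
  let cm : X × M × M → Y := fun z => if h : ∃ c, Q z c then h.choose else 0
  have hcm : ∀ z c, Q z c → cm z = c := by
    intro z c h
    have h' : ∃ c, Q z c := ⟨c, h⟩
    simp only [cm, dif_pos h']
    exact hQ z _ _ h'.choose_spec h
  refine ⟨cm, fun q hq => ?_⟩
  set z₀ : X × M × M := (q.1, q.2, q.2) with hz₀
  have hΦ0 : Φ (z₀, 0) = 0 := by simp [Φ, z₀, hZ q hq]
  have hcd : ContDiffAt ℝ 1 Φ (z₀, 0) := hΦ.contDiffAt
  have hder : (fderiv ℝ Φ (z₀, 0)) ∘L .inr ℝ (X × M × M) Y =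
      (fderiv ℝ (fun x => g (x, q.2)) q.1) ∘L ν q := by
    have h1 : HasFDerivAt (fun c : Y => Φ (z₀, c))
        ((fderiv ℝ Φ (z₀, 0)) ∘L .inr ℝ (X × M × M) Y) 0 := by
      have := (hcd.differentiableAt one_ne_zero).hasFDerivAt
      exact this.comp (0 : Y) (hasFDerivAt_prodMk_right z₀ (0 : Y))
    have h2 : HasFDerivAt (fun c : Y => Φ (z₀, c))
        ((fderiv ℝ (fun x => g (x, q.2)) q.1) ∘L ν q) 0 := by
      have hd : DifferentiableAt ℝ (fun x => g (x, q.2)) (q.1 + ν q 0) := by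
        have : ContDiff ℝ 1 (fun x => g (x, q.2)) := hg.comp (by fun_prop)
        exact (this.differentiable one_ne_zero) _
      have h3 : HasFDerivAt (fun c : Y => q.1 + ν q c) (ν q) 0 :=
        (ν q).hasFDerivAt.const_add q.1
      have := hd.hasFDerivAt.comp (0 : Y) h3
      simpa [Function.comp_def] using this
    exact h1.unique h2
  have hinv : ((fderiv ℝ Φ (z₀, 0)) ∘L .inr ℝ (X × M × M) Y).IsInvertible := by
    rw [hder]
    set A := (fderiv ℝ (fun x => g (x, q.2)) q.1) ∘L ν q with hA
    have hAi : Function.Injective (A : Y →ₗ[ℝ] Y) := by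
      rw [injective_iff_map_eq_zero]
      exact fun c hc => hinj q hq c hc
    refine ⟨(LinearEquiv.ofInjectiveEndo (A : Y →ₗ[ℝ] Y) hAi).toContinuousLinearEquiv, ?_⟩
    ext c
    rfl
  let φ := hcd.implicitFunction one_ne_zero hinv
  have e1 : ∀ᶠ v in 𝓝 (z₀, (0 : Y)), Φ v = Φ (z₀, 0) ↔ φ v.1 = v.2 :=
    hcd.eventually_apply_eq_iff_implicitFunction one_ne_zero hinv
  have hφc : ContDiffAt ℝ 1 φ z₀ := hcd.contDiffAt_implicitFunction one_ne_zero hinv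
  have hφ0 : φ z₀ = 0 := e1.self_of_nhds.mp rfl
  rw [hΦ0, nhds_prod_eq] at e1
  obtain ⟨P, hP, R, hR, hPR⟩ := eventually_prod_iff.mp e1
  obtain ⟨ρ, hρ, hρR⟩ := Metric.eventually_nhds_iff.mp hR
  have hφsmall : ∀ᶠ z in 𝓝 z₀, ‖φ z‖ < ρ := by
    have := hφc.continuousAt.norm
    rw [ContinuousAt, hφ0, norm_zero] at this
    exact this.eventually (gt_mem_nhds hρ)
  have hQφ : ∀ᶠ z in 𝓝 z₀, Q z (φ z) := by
    filter_upwards [hP, hφsmall] with z hz hs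
    refine ⟨(hPR hz (hρR (by simpa using hs))).mpr rfl, fun c' hc' hne => ?_⟩
    by_contra hlt
    exact hne ((hPR hz (hρR (by
      rw [dist_zero_right]; exact lt_of_le_of_lt (not_lt.mp hlt) hs))).mp hc').symm
  have heq : ∀ᶠ z in 𝓝 z₀, cm z = φ z := hQφ.mono fun z hz => hcm z _ hz
  refine ⟨heq.self_of_nhds.trans hφ0, ?_⟩
  filter_upwards [hQφ, heq, heq.eventually_nhds, hφc.eventually (by simp)] with z h1 h2 h3 h4
  refine ⟨h4.continuousAt.congr (h3.mono fun _ h => h.symm), ?_⟩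
  rw [h2]
  exact h1.1

open Filter Topology in
/-- A family of bounded, regularly defined zero sets over a contractible base is homotopy
equivalent to each of its members. -/
theorem homotopyEquiv_zeroSet_fiber {X M Y : Type*} [NormedAddCommGroup X] [NormedSpace ℝ X]
    [FiniteDimensional ℝ X] [NormedAddCommGroup M] [NormedSpace ℝ M] [FiniteDimensional ℝ M]
    [NormedAddCommGroup Y] [NormedSpace ℝ Y] [FiniteDimensional ℝ Y]
    {B : Set M} [ContractibleSpace B] {g : X × M → Y} (hg : ContDiff ℝ 1 g)
    {ν : X × M → Y →L[ℝ] X} (hν : ContDiff ℝ 1 ν) {R : ℝ}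
    (hbdd : ∀ x, ∀ b ∈ B, g (x, b) = 0 → ‖x‖ ≤ R)
    (hinj : ∀ x, ∀ b ∈ B, g (x, b) = 0 → ∀ c,
      fderiv ℝ (fun x => g (x, b)) x (ν (x, b) c) = 0 → c = 0) {b₀ : M} (hb₀ : b₀ ∈ B) :
    Nonempty (ContinuousMap.HomotopyEquiv {q : X × M | q.2 ∈ B ∧ g q = 0}
      {x : X | g (x, b₀) = 0}) := by
  classical
  obtain ⟨cm, hcm⟩ := exists_minimal_correction (Z := {q : X × M | q.2 ∈ B ∧ g q = 0}) hg hν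
    (fun q hq => hq.2) (fun q hq => hinj q.1 q.2 hq.1 hq.2)
  have := FiniteDimensional.proper ℝ X
  let N : Set (X × M × M) := interior {z | ContinuousAt cm z ∧
    g (z.1 + ν (z.1, z.2.1) (cm z), z.2.2) = 0}
  have hNo : IsOpen N := isOpen_interior
  have hNd : ∀ q : X × M, q.2 ∈ B → g q = 0 → (q.1, q.2, q.2) ∈ N := fun q h1 h2 =>
    mem_interior_iff_mem_nhds.mpr (hcm q ⟨h1, h2⟩).2
  have hNs : ∀ z ∈ N, ContinuousAt cm z ∧ g (z.1 + ν (z.1, z.2.1) (cm z), z.2.2) = 0 :=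
    fun z hz => (interior_subset (s := {z | ContinuousAt cm z ∧
      g (z.1 + ν (z.1, z.2.1) (cm z), z.2.2) = 0}) hz :)
  let E : Set (X × M) := {q : X × M | q.2 ∈ B ∧ g q = 0}
  let p : E → B := fun e => ⟨e.1.2, e.2.1⟩
  have hp : Continuous p := by fun_prop
  let W : Set (B × B) := {w | ∀ x, g (x, w.1.1) = 0 → (x, w.1.1, w.2.1) ∈ N}
  have hW : IsOpen W := by
    rw [isOpen_iff_mem_nhds]
    rintro ⟨b, b'⟩ hbb
    let O : Set (X × (B × B)) := {q | g (q.1, q.2.1.1) ≠ 0 ∨ (q.1, q.2.1.1, q.2.2.1) ∈ N}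
    have hO : IsOpen O := by
      refine IsOpen.union ?_ (hNo.preimage (by fun_prop))
      have : Continuous fun q : X × (B × B) => g (q.1, q.2.1.1) :=
        hg.continuous.comp (by fun_prop)
      exact isOpen_ne.preimage this
    obtain ⟨u, v, hu, hv, hCu, hbv, huv⟩ := generalized_tube_lemma
      (isCompact_closedBall (0 : X) R) (isCompact_singleton (x := (b, b'))) hO (by
        rintro ⟨x, w⟩ ⟨-, hw⟩
        have hw : w = (b, b') := hw
        subst hw
        by_cases h : g (x, b.1) = 0
        · exact Or.inr (hbb x h)
        · exact Or.inl h)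
    refine Filter.mem_of_superset (hv.mem_nhds (hbv rfl)) fun w hw x hx => ?_
    have hxu : x ∈ u := hCu (by simpa using hbdd x w.1.1 w.1.2 hx)
    exact (huv (Set.mk_mem_prod hxu hw)).resolve_left (fun h => h hx)
  have hdiag : ∀ b : B, (b, b) ∈ W := fun b x hx => hNd (x, b.1) b.2 hx
  let σ : E × B → X × M := fun q => (q.1.1.1 + ν q.1.1 (cm (q.1.1.1, q.1.1.2, q.2.1)), q.2.1)
  let τ : E × B → E := fun q => if h : (q.1.1.1, q.1.1.2, q.2.1) ∈ N then
    ⟨σ q, q.2.2, (hNs _ h).2⟩ else q.1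
  have hτσ : ∀ q : E × B, (q.1.1.1, q.1.1.2, q.2.1) ∈ N → (τ q).1 = σ q := by
    intro q h
    simp only [τ, dif_pos h]
  have hWN : ∀ q : E × B, (p q.1, q.2) ∈ W → (q.1.1.1, q.1.1.2, q.2.1) ∈ N :=
    fun q hq => hq q.1.1.1 q.1.2.2
  obtain ⟨e⟩ := homotopyEquiv_fiber (p := p) hp hW hdiag (τ := τ) (by
      rw [Topology.IsInducing.subtypeVal.continuousOn_iff]
      refine ContinuousOn.congr (f := σ) ?_ (fun q hq => hτσ q (hWN q hq))
      intro q hq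
      refine ContinuousAt.continuousWithinAt ?_
      have hc : ContinuousAt (fun q : E × B => cm (q.1.1.1, q.1.1.2, q.2.1)) q :=
        ContinuousAt.comp (f := fun q : E × B => (q.1.1.1, q.1.1.2, q.2.1))
          (hNs _ (hWN q hq)).1 (by fun_prop)
      have hν' : ContinuousAt (fun q : E × B => ν q.1.1) q :=
        (hν.continuous.comp (by fun_prop)).continuousAt
      exact ContinuousAt.prodMk (ContinuousAt.add (by fun_prop) (hν'.clm_apply hc)) (by fun_prop))
    (by
      intro q hq
      apply Subtype.ext
      show (τ q).1.2 = _
      rw [hτσ q (hWN q hq)])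
    (by
      intro e
      have h : (e.1.1, e.1.2, (p e).1) ∈ N := hNd e.1 e.2.1 e.2.2
      apply Subtype.ext
      rw [hτσ (e, p e) h]
      have h0 : cm (e.1.1, e.1.2, (p e).1) = 0 := (hcm e.1 e.2).1
      simp only [σ, h0, map_zero, add_zero]
      rfl) ⟨b₀, hb₀⟩
  refine ⟨e.trans (Homeomorph.toHomotopyEquiv ?_)⟩
  exact
    { toFun := fun e => ⟨e.1.1.1, by
        have h : e.1.1.2 = b₀ := congrArg Subtype.val e.2
        have h2 : (e.1.1.1, b₀) = e.1.1 := Prod.ext rfl h.symm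
        exact (congrArg g h2).trans e.1.2.2⟩
      invFun := fun x => ⟨⟨(x.1, b₀), hb₀, x.2⟩, rfl⟩
      left_inv := fun e => by
        have h : e.1.1.2 = b₀ := congrArg Subtype.val e.2
        apply Subtype.ext
        apply Subtype.ext
        exact Prod.ext rfl h.symm
      right_inv := fun x => rfl
      continuous_toFun := by fun_prop
      continuous_invFun := by fun_prop }

open Filter Topology in
theorem Ultrafilter.bounded_or_tendsto {Z : Type*} (𝒰 : Ultrafilter Z) (h : Z → ℝ) :
    (∃ C, ∀ᶠ z in 𝒰, |h z| ≤ C) ∨ Tendsto h 𝒰 atTop ∨ Tendsto h 𝒰 atBot := by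
  by_cases hb : ∃ C, ∀ᶠ z in 𝒰, |h z| ≤ C
  · exact Or.inl hb
  right
  push Not at hb
  rcases Ultrafilter.eventually_or.mp (Eventually.of_forall (f := (𝒰 : Filter Z))
    fun z => le_total 0 (h z)) with h0 | h0
  · left
    rw [tendsto_atTop]
    intro C
    filter_upwards [hb C, h0] with z h1 h2
    rw [abs_of_nonneg h2] at h1
    exact h1.le
  · right
    rw [tendsto_atBot]
    intro C
    filter_upwards [hb (-C), h0] with z h1 h2
    rw [abs_of_nonpos h2] at h1
    linarith

open Filter Topology in
theorem Ultrafilter.tendsto_atTop_of_nonneg {Z : Type*} (𝒰 : Ultrafilter Z) {h : Z → ℝ}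
    (h0 : ∀ᶠ z in 𝒰, 0 ≤ h z) (hb : ¬ ∃ C, ∀ᶠ z in 𝒰, |h z| ≤ C) : Tendsto h 𝒰 atTop := by
  rcases 𝒰.bounded_or_tendsto h with h1 | h1 | h1
  · exact absurd h1 hb
  · exact h1
  · obtain ⟨z, hz, hz'⟩ := (h0.and (h1.eventually (eventually_lt_atBot 0))).exists
    exact absurd hz (not_le.mpr hz')

open Filter Topology in
theorem not_bounded_of_tendsto_atTop {Z : Type*} {l : Filter Z} [l.NeBot] {h : Z → ℝ}
    (ht : Tendsto h l atTop) : ¬ ∃ C, ∀ᶠ z in l, |h z| ≤ C := by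
  rintro ⟨C, hC⟩
  obtain ⟨z, hz, hz'⟩ := (hC.and (ht.eventually (eventually_gt_atTop C))).exists
  exact absurd ((le_abs_self _).trans hz) (not_le.mpr hz')

open Filter in
/-- A family of vectors can be moved by a bounded amount so that every functional from a finite
list which is bounded along the family vanishes on it. -/
theorem exists_bounded_correction {Z V ι : Type*} [NormedAddCommGroup V] [NormedSpace ℝ V]
    [FiniteDimensional ℝ V] [Fintype ι] (l : Filter Z) (L : ι → V →ₗ[ℝ] ℝ) (u : Z → V) :
    ∃ v : Z → V, (∃ C, ∀ᶠ z in l, ‖u z - v z‖ ≤ C) ∧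
      ∀ j, (∃ C, ∀ᶠ z in l, |L j (u z)| ≤ C) → ∀ z, L j (v z) = 0 := by
  classical
  let J := {j : ι // ∃ C, ∀ᶠ z in l, |L j (u z)| ≤ C}
  let T : V →ₗ[ℝ] (J → ℝ) := LinearMap.pi fun j => L j.1
  obtain ⟨S₀, hS₀⟩ := T.rangeRestrict.exists_rightInverse_of_surjective T.range_rangeRestrict
  obtain ⟨S, hS⟩ := LinearMap.exists_extend S₀
  have hTS : ∀ w, T (S (T w)) = T w := by
    intro w
    have h1 : S (T w) = S₀ (T.rangeRestrict w) := by
      rw [← hS]; rfl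
    have h2 := LinearMap.congr_fun hS₀ (T.rangeRestrict w)
    rw [h1]
    exact congrArg Subtype.val h2
  refine ⟨fun z => u z - S (T (u z)), ?_, ?_⟩
  · choose C hC using fun j : J => j.2
    have hev : ∀ᶠ z in l, ∀ j : J, |L j.1 (u z)| ≤ C j := eventually_all.mpr hC
    let S' := LinearMap.toContinuousLinearMap S
    refine ⟨‖S'‖ * ∑ j, |C j|, ?_⟩
    filter_upwards [hev] with z hz
    rw [sub_sub_cancel]
    refine (S'.le_opNorm (T (u z))).trans (mul_le_mul_of_nonneg_left ?_ (norm_nonneg _))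
    rw [pi_norm_le_iff_of_nonneg (Finset.sum_nonneg fun _ _ => abs_nonneg _)]
    intro j
    refine ((hz j).trans (le_abs_self _)).trans ?_
    exact Finset.single_le_sum (f := fun j => |C j|) (fun _ _ => abs_nonneg _) (Finset.mem_univ j)
  · intro j hj z
    have := congrFun (hTS (u z)) ⟨j, hj⟩
    have h2 : L j (S (T (u z))) = L j (u z) := this
    rw [map_sub, h2, sub_self]

/-- The weight of an exponent vector as a linear functional of the weights of the variables. -/
def expWeight {n : ℕ} (α : Fin n →₀ ℕ) : (Fin n → ℝ) →ₗ[ℝ] ℝ :=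
  ∑ i, (α i : ℝ) • LinearMap.proj i

theorem expWeight_apply {n : ℕ} (α : Fin n →₀ ℕ) (w : Fin n → ℝ) :
    expWeight α w = ∑ i, (α i : ℝ) * w i := by
  simp [expWeight]

theorem expWeight_single {n : ℕ} (i : Fin n) (m : ℕ) (w : Fin n → ℝ) :
    expWeight (Finsupp.single i m) w = m * w i := by
  rw [expWeight_apply, Finset.sum_eq_single i]
  · simp
  · intro j _ hj
    simp [Finsupp.single_eq_of_ne hj]
  · simp

open Filter Topology in
theorem tendsto_atTop_of_bounded_diff {Z V : Type*} [NormedAddCommGroup V] [NormedSpace ℝ V]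
    [FiniteDimensional ℝ V] {l : Filter Z} (L : V →ₗ[ℝ] ℝ) {u v : Z → V}
    (huv : ∃ C, ∀ᶠ z in l, ‖u z - v z‖ ≤ C) (hu : Tendsto (fun z => L (u z)) l atTop) :
    Tendsto (fun z => L (v z)) l atTop := by
  obtain ⟨C, hC⟩ := huv
  let L' := LinearMap.toContinuousLinearMap L
  have h1 : Tendsto (fun z => L (u z) + -(‖L'‖ * C)) l atTop := tendsto_atTop_add_const_right _ _ hu
  refine tendsto_atTop_mono' l ?_ h1
  filter_upwards [hC] with z hz
  have h2 : ‖L' (u z - v z)‖ ≤ ‖L'‖ * C :=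
    (L'.le_opNorm _).trans (mul_le_mul_of_nonneg_left hz (norm_nonneg _))
  have h3 : L' (u z - v z) = L (u z) - L (v z) := map_sub L _ _
  rw [h3, Real.norm_eq_abs, abs_le] at h2
  linarith [h2.2]

open Filter Topology in
/-- Leading monomials of a family of points tending to the origin along an ultrafilter: after
rescaling, monomials converge, and the leading ones are those minimizing suitable weights. -/
theorem exists_tropical_limit {n : ℕ} {Z : Type*} (𝒰 : Ultrafilter Z) {x : Z → Fin n → ℂ}
    (hx : Tendsto x 𝒰 (𝓝 0)) (hx0 : ∀ᶠ z in 𝒰, x z ≠ 0) {A : Finset (Fin n →₀ ℕ)}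
    (hA : ∀ i, ∃ m : ℕ, Finsupp.single i m ∈ A) :
    ∃ (v : Z → Fin n → ℝ) (b : Fin n → ℂ) (α₀ : Fin n →₀ ℕ) (i₀ : Fin n)
      (F : Set (Fin n →₀ ℕ)) (J : Set (Fin n)),
      (∀ i, b i ≠ 0) ∧ α₀ ∈ A ∧ i₀ ∈ J ∧ (∀ i, ∀ᶠ z in 𝒰, 0 < v z i) ∧
      (∀ α ∈ A, α ∈ F → ∀ z, expWeight α (v z) = expWeight α₀ (v z)) ∧
      (∀ α ∈ A, α ∉ F → ∀ᶠ z in 𝒰, expWeight α₀ (v z) < expWeight α (v z)) ∧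
      (∀ i ∈ J, ∀ z, v z i = v z i₀) ∧
      (∀ α ∈ A, Tendsto (fun z => (Real.exp (expWeight α₀ (v z)) : ℂ) * ∏ i, x z i ^ α i) 𝒰
        (𝓝 (F.indicator (fun α => ∏ i, b i ^ α i) α))) ∧
      (∀ i, Tendsto (fun z => Real.exp (2 * v z i₀) * ‖x z i‖ ^ 2) 𝒰
        (𝓝 (J.indicator (fun i => ‖b i‖ ^ 2) i))) := by
  classical
  have hxi : ∀ i, Tendsto (fun z => x z i) 𝒰 (𝓝 0) := fun i => by
    simpa using (tendsto_pi_nhds.mp hx) i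
  have hlt1 : ∀ i, ∀ᶠ z in 𝒰, ‖x z i‖ < 1 := fun i => by
    have := (hxi i).norm
    rw [norm_zero] at this
    exact this.eventually (gt_mem_nhds one_pos)
  let I0 : Set (Fin n) := {i | ∀ᶠ z in 𝒰, x z i = 0}
  have hI0 : ∀ i, i ∉ I0 → ∀ᶠ z in 𝒰, x z i ≠ 0 := fun i hi => Ultrafilter.eventually_not.mpr hi
  let ℓ : Z → Fin n → ℝ := fun z i => -Real.log ‖x z i‖
  have hℓ0 : ∀ i, ∀ᶠ z in 𝒰, 0 ≤ ℓ z i := fun i => by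
    filter_upwards [hlt1 i] with z hz
    exact neg_nonneg.mpr (Real.log_nonpos (norm_nonneg _) hz.le)
  have hℓ0' : ∀ᶠ z in 𝒰, ∀ i, 0 ≤ ℓ z i := eventually_all.mpr hℓ0
  have hℓtop : ∀ i, i ∉ I0 → Tendsto (fun z => ℓ z i) 𝒰 atTop := fun i hi => by
    refine tendsto_neg_atBot_atTop.comp (Real.tendsto_log_nhdsNE_zero.comp ?_)
    refine tendsto_nhdsWithin_iff.mpr ⟨by simpa using (hxi i).norm, ?_⟩
    exact (hI0 i hi).mono fun z hz => norm_ne_zero_iff.mpr hz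
  let s : Z → ℝ := fun z => ∑ i, ℓ z i
  have hℓs : ∀ i, ∀ᶠ z in 𝒰, ℓ z i ≤ s z := fun i => by
    filter_upwards [hℓ0'] with z hz
    exact Finset.single_le_sum (f := fun i => ℓ z i) (fun i _ => hz i) (Finset.mem_univ i)
  obtain ⟨i₀, hi₀⟩ : ∃ i₀, ∀ᶠ z in 𝒰, x z i₀ ≠ 0 ∧ ∀ i, ‖x z i‖ ≤ ‖x z i₀‖ := by
    refine Ultrafilter.eventually_exists_iff.mp ?_
    filter_upwards [hx0] with z hz
    obtain ⟨j, hj⟩ := Function.ne_iff.mp hz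
    obtain ⟨i₀, -, hmax⟩ := Finset.exists_max_image Finset.univ (fun i => ‖x z i‖) ⟨j, by simp⟩
    refine ⟨i₀, ?_, fun i => hmax i (by simp)⟩
    have h1 := hmax j (by simp)
    have h2 : 0 < ‖x z j‖ := norm_pos_iff.mpr hj
    exact norm_pos_iff.mp (h2.trans_le h1)
  have hi₀I : i₀ ∉ I0 := fun h => by
    obtain ⟨z, h1, h2⟩ := ((show ∀ᶠ z in 𝒰, x z i₀ = 0 from h).and hi₀).exists
    exact h2.1 h1
  have hs : Tendsto s 𝒰 atTop := tendsto_atTop_mono' _ (hℓs i₀) (hℓtop i₀ hi₀I)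
  let u : Z → Fin n → ℝ := fun z i => if x z i = 0 then s z ^ 2 else ℓ z i
  have hu0 : ∀ i ∈ I0, ∀ᶠ z in 𝒰, u z i = s z ^ 2 := fun i hi =>
    (show ∀ᶠ z in 𝒰, x z i = 0 from hi).mono fun z hz => if_pos hz
  have hu1 : ∀ i, i ∉ I0 → ∀ᶠ z in 𝒰, u z i = ℓ z i := fun i hi =>
    (hI0 i hi).mono fun z hz => if_neg hz
  have hutop : ∀ i, Tendsto (fun z => u z i) 𝒰 atTop := fun i => by
    by_cases hi : i ∈ I0
    · exact ((tendsto_pow_atTop two_ne_zero).comp hs).congr' ((hu0 i hi).mono fun z h => h.symm)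
    · exact (hℓtop i hi).congr' ((hu1 i hi).mono fun z h => h.symm)
  have hunn : ∀ᶠ z in 𝒰, ∀ i, 0 ≤ u z i :=
    eventually_all.mpr fun i => (hutop i).eventually (eventually_ge_atTop 0)
  have hu0s : ∀ᶠ z in 𝒰, u z i₀ ≤ s z := by
    filter_upwards [hu1 i₀ hi₀I, hℓs i₀] with z h1 h2
    rw [h1]; exact h2
  have hsq : ∀ m : ℝ, Tendsto (fun z => s z ^ 2 - m * s z) 𝒰 atTop := fun m => by
    have h1 : Tendsto (fun z => s z * (s z + -m)) 𝒰 atTop :=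
      hs.atTop_mul_atTop₀ (tendsto_atTop_add_const_right _ _ hs)
    exact h1.congr fun z => by ring
  obtain ⟨m, hm⟩ := hA i₀
  obtain ⟨α₀, hα₀A, hα₀⟩ : ∃ α₀ ∈ (A : Set (Fin n →₀ ℕ)),
      ∀ᶠ z in 𝒰, ∀ α ∈ A, expWeight α₀ (u z) ≤ expWeight α (u z) := by
    refine (Ultrafilter.eventually_exists_mem_iff A.finite_toSet).mp ?_
    refine Eventually.of_forall fun z => ?_
    exact Finset.exists_min_image A (fun α => expWeight α (u z)) ⟨_, hm⟩
  have hbad : ∀ α : Fin n →₀ ℕ, (∃ i ∈ I0, α i ≠ 0) →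
      Tendsto (fun z => expWeight α (u z) - expWeight α₀ (u z)) 𝒰 atTop := by
    rintro α ⟨i, hi, hαi⟩
    refine tendsto_atTop_mono' _ ?_ (hsq m)
    filter_upwards [hu0 i hi, hunn, hα₀, hu0s] with z h1 h2 h3 h4
    have h5 := h3 _ hm
    rw [expWeight_single] at h5
    have h6 : (m : ℝ) * u z i₀ ≤ m * s z := mul_le_mul_of_nonneg_left h4 (Nat.cast_nonneg _)
    have h7 : s z ^ 2 ≤ expWeight α (u z) := by
      rw [expWeight_apply, ← h1]
      refine le_trans ?_ (Finset.single_le_sum (f := fun j => (α j : ℝ) * u z j)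
        (fun j _ => mul_nonneg (Nat.cast_nonneg _) (h2 j)) (Finset.mem_univ i))
      have : (1 : ℝ) ≤ α i := by exact_mod_cast Nat.one_le_iff_ne_zero.mpr hαi
      nlinarith [h2 i]
    linarith
  let ι := {α // α ∈ A} ⊕ Fin n
  let Λ : ι → (Fin n → ℝ) →ₗ[ℝ] ℝ := Sum.elim (fun α => expWeight α.1 - expWeight α₀)
    (fun i =>
      (LinearMap.proj i : (Fin n → ℝ) →ₗ[ℝ] ℝ) - (LinearMap.proj i₀ : (Fin n → ℝ) →ₗ[ℝ] ℝ))
  obtain ⟨v, huv, hv0⟩ := exists_bounded_correction (𝒰 : Filter Z) Λ u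
  let F : Set (Fin n →₀ ℕ) := {α | ∃ C, ∀ᶠ z in 𝒰, |expWeight α (u z) - expWeight α₀ (u z)| ≤ C}
  let J : Set (Fin n) := {i | ∃ C, ∀ᶠ z in 𝒰, |u z i - u z i₀| ≤ C}
  have hFv : ∀ α ∈ A, α ∈ F → ∀ z, expWeight α (v z) = expWeight α₀ (v z) := by
    intro α hαA hαF z
    exact sub_eq_zero.mp (hv0 (Sum.inl ⟨α, hαA⟩) hαF z)
  have hFt : ∀ α ∈ A, α ∉ F →
      Tendsto (fun z => expWeight α (v z) - expWeight α₀ (v z)) 𝒰 atTop := by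
    intro α hαA hαF
    refine tendsto_atTop_of_bounded_diff (expWeight α - expWeight α₀) huv ?_
    refine 𝒰.tendsto_atTop_of_nonneg ?_ hαF
    filter_upwards [hα₀] with z hz
    exact sub_nonneg.mpr (hz α hαA)
  have hJv : ∀ i ∈ J, ∀ z, v z i = v z i₀ := by
    intro i hi z
    exact sub_eq_zero.mp (hv0 (Sum.inr i) hi z)
  have hui₀ : ∀ i, ∀ᶠ z in 𝒰, 0 ≤ u z i - u z i₀ := by
    intro i
    by_cases hi : i ∈ I0
    · filter_upwards [(hsq 1).eventually (eventually_ge_atTop 0), hu0 i hi, hu0s] with z h1 h2 h3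
      rw [h2]; linarith
    · filter_upwards [hu1 i hi, hu1 i₀ hi₀I, hi₀, hI0 i hi] with z h1 h2 h3 h4
      rw [h1, h2]
      have := Real.log_le_log (norm_pos_iff.mpr h4) (h3.2 i)
      simp only [ℓ]; linarith
  have hJt : ∀ i, i ∉ J → Tendsto (fun z => v z i - v z i₀) 𝒰 atTop := by
    intro i hi
    have h1 := 𝒰.tendsto_atTop_of_nonneg (hui₀ i) hi
    exact tendsto_atTop_of_bounded_diff ((LinearMap.proj i : (Fin n → ℝ) →ₗ[ℝ] ℝ) -
      (LinearMap.proj i₀ : (Fin n → ℝ) →ₗ[ℝ] ℝ)) huv h1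
  have hJI : ∀ i ∈ I0, i ∉ J := by
    intro i hi hJ
    refine not_bounded_of_tendsto_atTop (tendsto_atTop_mono' _ ?_ (hsq 1)) hJ
    filter_upwards [hu0 i hi, hu0s] with z h2 h3
    rw [h2]; linarith
  have hvtop : ∀ i, Tendsto (fun z => v z i) 𝒰 atTop := fun i =>
    tendsto_atTop_of_bounded_diff (LinearMap.proj i : (Fin n → ℝ) →ₗ[ℝ] ℝ) huv (hutop i)
  let β : Z → Fin n → ℂ := fun z i =>
    (if x z i = 0 then 1 else x z i / (‖x z i‖ : ℂ)) * (Real.exp (v z i - u z i) : ℂ)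
  have hβn : ∀ z i, ‖β z i‖ = Real.exp (v z i - u z i) := by
    intro z i
    simp only [β, norm_mul, Complex.norm_real, Real.norm_eq_abs, Real.abs_exp]
    split_ifs with h
    · simp
    · rw [norm_div, Complex.norm_real, norm_norm, div_self (norm_ne_zero_iff.mpr h), one_mul]
  obtain ⟨C, hC⟩ := huv
  have hβlim : ∀ i, ∃ b : ℂ, b ≠ 0 ∧ Tendsto (fun z => β z i) 𝒰 (𝓝 b) := by
    intro i
    have hK : IsCompact {y : ℂ | Real.exp (-C) ≤ ‖y‖ ∧ ‖y‖ ≤ Real.exp C} := by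
      refine Metric.isCompact_of_isClosed_isBounded ?_ ?_
      · exact (isClosed_le continuous_const continuous_norm).inter
          (isClosed_le continuous_norm continuous_const)
      · exact (Metric.isBounded_closedBall (x := (0 : ℂ)) (r := Real.exp C)).subset fun y hy => by
          simpa using hy.2
    obtain ⟨b, hb, hle⟩ := hK.ultrafilter_le_nhds (𝒰.map fun z => β z i) (by
      rw [Ultrafilter.coe_map, Filter.le_principal_iff, Filter.mem_map]
      filter_upwards [hC] with z hz
      have h1 := (norm_le_pi_norm (u z - v z) i).trans hz
      rw [Pi.sub_apply, Real.norm_eq_abs, abs_le] at h1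
      simp only [Set.mem_preimage, Set.mem_ofPred_eq, hβn]
      exact ⟨Real.exp_le_exp.mpr (by linarith), Real.exp_le_exp.mpr (by linarith)⟩)
    refine ⟨b, ?_, hle⟩
    intro h0
    have := hb.1
    rw [h0, norm_zero] at this
    exact absurd this (not_le.mpr (Real.exp_pos _))
  choose b hb0 hb using hβlim
  have hxβ : ∀ i, i ∉ I0 → ∀ᶠ z in 𝒰, x z i = β z i * (Real.exp (-v z i) : ℂ) := by
    intro i hi
    filter_upwards [hI0 i hi] with z hz
    have hn : ‖x z i‖ ≠ 0 := norm_ne_zero_iff.mpr hz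
    have hu : u z i = -Real.log ‖x z i‖ := if_neg hz
    simp only [β, if_neg hz, mul_assoc]
    rw [← Complex.ofReal_mul, ← Real.exp_add, hu]
    have : v z i - -Real.log ‖x z i‖ + -v z i = Real.log ‖x z i‖ := by ring
    rw [this, Real.exp_log (norm_pos_iff.mpr hz), div_mul_cancel₀]
    exact_mod_cast hn
  refine ⟨v, b, α₀, i₀, F, J, hb0, hα₀A, ⟨0, by simp⟩,
    fun i => (hvtop i).eventually (eventually_gt_atTop 0), hFv, ?_, hJv, ?_, ?_⟩
  · intro α hαA hαF
    filter_upwards [(hFt α hαA hαF).eventually (eventually_gt_atTop 0)] with z hz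
    linarith
  · intro α hαA
    by_cases hα : ∃ i ∈ I0, α i ≠ 0
    · have hαF : α ∉ F := not_bounded_of_tendsto_atTop (hbad α hα)
      obtain ⟨i, hi, hαi⟩ := hα
      rw [Set.indicator_of_notMem hαF]
      refine tendsto_const_nhds.congr' ?_
      filter_upwards [show ∀ᶠ z in 𝒰, x z i = 0 from hi] with z hz
      rw [Finset.prod_eq_zero (Finset.mem_univ i) (by rw [hz, zero_pow hαi]), mul_zero]
    · push Not at hα
      have hprod : ∀ᶠ z in 𝒰, (∏ i, β z i ^ α i) *
          (Real.exp (-(expWeight α (v z) - expWeight α₀ (v z))) : ℂ) =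
          (Real.exp (expWeight α₀ (v z)) : ℂ) * ∏ i, x z i ^ α i := by
        have : ∀ᶠ z in 𝒰, ∀ i, x z i ^ α i = (β z i * (Real.exp (-v z i) : ℂ)) ^ α i := by
          refine eventually_all.mpr fun i => ?_
          by_cases hi : i ∈ I0
          · exact Eventually.of_forall fun z => by rw [hα i hi, pow_zero, pow_zero]
          · filter_upwards [hxβ i hi] with z hz
            rw [← hz]
        filter_upwards [this] with z hz
        rw [Finset.prod_congr rfl fun i _ => hz i]
        simp only [mul_pow, Finset.prod_mul_distrib]
        have h1 : ∏ i, (Real.exp (-v z i) : ℂ) ^ α i = (Real.exp (-expWeight α (v z)) : ℂ) := by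
          rw [expWeight_apply, ← Finset.sum_neg_distrib, Real.exp_sum, Complex.ofReal_prod]
          refine Finset.prod_congr rfl fun i _ => ?_
          rw [← Complex.ofReal_pow, ← Real.exp_nat_mul]
          congr 2
          ring
        rw [h1, neg_sub, Real.exp_sub, Real.exp_neg]
        push_cast
        ring
      have hβp : Tendsto (fun z => ∏ i, β z i ^ α i) 𝒰 (𝓝 (∏ i, b i ^ α i)) :=
        tendsto_finsetProd _ fun i _ => (hb i).pow _
      refine Tendsto.congr' hprod ?_
      by_cases hαF : α ∈ F
      · rw [Set.indicator_of_mem hαF]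
        refine hβp.congr fun z => ?_
        rw [hFv α hαA hαF z]
        simp
      · rw [Set.indicator_of_notMem hαF]
        have h1 : Tendsto (fun z => Real.exp (-(expWeight α (v z) - expWeight α₀ (v z)))) 𝒰 (𝓝 0) :=
          Real.tendsto_exp_neg_atTop_nhds_zero.comp (hFt α hαA hαF)
        have h2 : Tendsto (fun z => (Real.exp (-(expWeight α (v z) - expWeight α₀ (v z))) : ℂ)) 𝒰
            (𝓝 ((0 : ℝ) : ℂ)) := (Complex.continuous_ofReal.tendsto 0).comp h1
        simpa using hβp.mul h2
  · intro i
    by_cases hi : i ∈ I0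
    · rw [Set.indicator_of_notMem (hJI i hi)]
      refine tendsto_const_nhds.congr' ?_
      filter_upwards [show ∀ᶠ z in 𝒰, x z i = 0 from hi] with z hz
      rw [hz]; simp
    · have hsqr : ∀ᶠ z in 𝒰, ‖β z i‖ ^ 2 * Real.exp (-(v z i - v z i₀)) ^ 2 =
          Real.exp (2 * v z i₀) * ‖x z i‖ ^ 2 := by
        filter_upwards [hxβ i hi] with z hz
        have hxn : ‖x z i‖ = ‖β z i‖ * Real.exp (-v z i) := by
          rw [hz, norm_mul, Complex.norm_real, Real.norm_eq_abs, Real.abs_exp]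
        rw [hxn, mul_pow, ← Real.exp_nat_mul, ← Real.exp_nat_mul, mul_left_comm, ← Real.exp_add]
        congr 2
        push_cast
        ring
      refine Tendsto.congr' hsqr ?_
      have hβp : Tendsto (fun z => ‖β z i‖ ^ 2) 𝒰 (𝓝 (‖b i‖ ^ 2)) := (hb i).norm.pow 2
      by_cases hJ : i ∈ J
      · rw [Set.indicator_of_mem hJ]
        refine hβp.congr fun z => ?_
        rw [hJv i hJ z]
        simp
      · rw [Set.indicator_of_notMem hJ]
        have h1 : Tendsto (fun z => Real.exp (-(v z i - v z i₀))) 𝒰 (𝓝 0) :=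
          Real.tendsto_exp_neg_atTop_nhds_zero.comp (hJt i hJ)
        simpa using hβp.mul (h1.pow 2)

open Filter Topology in
/-- If the critical equations of the squared norm on hypersurfaces with convergent coefficients
are solvable at points tending to the origin, then some initial form of the limit has a critical
point with value zero in the torus. -/
theorem exists_initial_form_singular {n : ℕ} {Z : Type*} (𝒰 : Ultrafilter Z) {x : Z → Fin n → ℂ}
    (hx : Tendsto x 𝒰 (𝓝 0)) (hx0 : ∀ᶠ z in 𝒰, x z ≠ 0) {A : Finset (Fin n →₀ ℕ)}
    (hA : ∀ i, ∃ m : ℕ, Finsupp.single i m ∈ A) {c : Z → (Fin n →₀ ℕ) → ℂ}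
    {c' : (Fin n →₀ ℕ) → ℂ} (hc : ∀ α ∈ A, Tendsto (fun z => c z α) 𝒰 (𝓝 (c' α)))
    (h0 : ∀ᶠ z in 𝒰, ∑ α ∈ A, c z α * ∏ i, x z i ^ α i = 0)
    (h1 : ∀ᶠ z in 𝒰, ∃ μ : ℂ, ∀ i,
      ∑ α ∈ A, c z α * ((α i : ℂ) * ∏ j, x z j ^ α j) = μ * (‖x z i‖ ^ 2 : ℝ)) :
    ∃ (w : Fin n → ℝ) (α₀ : Fin n →₀ ℕ) (b : Fin n → ℂ), (∀ i, 0 < w i) ∧ α₀ ∈ A ∧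
      (∀ α ∈ A, expWeight α₀ w ≤ expWeight α w) ∧ (∀ i, b i ≠ 0) ∧
      ∑ α ∈ A with expWeight α w = expWeight α₀ w, c' α * ∏ i, b i ^ α i = 0 ∧
      ∀ i, ∑ α ∈ A with expWeight α w = expWeight α₀ w,
        c' α * ((α i : ℂ) * ∏ j, b j ^ α j) = 0 := by
  classical
  obtain ⟨v, b, α₀, i₀, F, J, hb, hα₀, hi₀, hv, hF, hF', hJ, hlim, hlimn⟩ :=
    exists_tropical_limit 𝒰 hx hx0 hA
  let E : Z → ℂ := fun z => (Real.exp (expWeight α₀ (v z)) : ℂ)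
  let m : (Fin n →₀ ℕ) → ℂ := F.indicator (fun α => ∏ i, b i ^ α i)
  have hP : ∑ α ∈ A, c' α * m α = 0 := by
    have ht : Tendsto (fun z => ∑ α ∈ A, c z α * (E z * ∏ i, x z i ^ α i)) 𝒰
        (𝓝 (∑ α ∈ A, c' α * m α)) :=
      tendsto_finsetSum _ fun α hα => (hc α hα).mul (hlim α hα)
    refine tendsto_nhds_unique ht (tendsto_const_nhds.congr' ?_)
    filter_upwards [h0] with z hz
    rw [← mul_zero (E z), ← hz, Finset.mul_sum]
    exact Finset.sum_congr rfl fun α _ => by ring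
  let Q : Fin n → ℂ := fun i => ∑ α ∈ A, c' α * ((α i : ℂ) * m α)
  have hQ : ∀ i, Tendsto (fun z => E z * ∑ α ∈ A, c z α * ((α i : ℂ) * ∏ j, x z j ^ α j)) 𝒰
      (𝓝 (Q i)) := by
    intro i
    have ht : Tendsto (fun z => ∑ α ∈ A, c z α * ((α i : ℂ) * (E z * ∏ i, x z i ^ α i))) 𝒰
        (𝓝 (Q i)) :=
      tendsto_finsetSum _ fun α hα => (hc α hα).mul ((hlim α hα).const_mul _)
    refine ht.congr fun z => ?_
    rw [Finset.mul_sum]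
    exact Finset.sum_congr rfl fun α _ => by ring
  obtain ⟨μ, hμ⟩ : ∃ μ : Z → ℂ, ∀ᶠ z in 𝒰, ∀ i,
      ∑ α ∈ A, c z α * ((α i : ℂ) * ∏ j, x z j ^ α j) = μ z * (‖x z i‖ ^ 2 : ℝ) := by
    refine ⟨fun z => if h : ∃ μ : ℂ, ∀ i, ∑ α ∈ A, c z α * ((α i : ℂ) * ∏ j, x z j ^ α j) =
      μ * (‖x z i‖ ^ 2 : ℝ) then h.choose else 0, ?_⟩
    filter_upwards [h1] with z hz
    rw [dif_pos hz]
    exact hz.choose_spec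
  let N : Fin n → ℝ := J.indicator (fun i => ‖b i‖ ^ 2)
  have hN₀ : N i₀ ≠ 0 := by
    simp only [N, Set.indicator_of_mem hi₀]
    exact pow_ne_zero _ (norm_ne_zero_iff.mpr (hb i₀))
  let r : Z → Fin n → ℝ := fun z i => Real.exp (2 * v z i₀) * ‖x z i‖ ^ 2
  have hr : ∀ i, Tendsto (fun z => (r z i : ℂ)) 𝒰 (𝓝 (N i : ℂ)) := fun i =>
    (Complex.continuous_ofReal.tendsto _).comp (hlimn i)
  let κ : Z → ℂ := fun z => E z * μ z * (Real.exp (2 * v z i₀) : ℂ)⁻¹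
  have hκ : ∀ i, ∀ᶠ z in 𝒰,
      E z * ∑ α ∈ A, c z α * ((α i : ℂ) * ∏ j, x z j ^ α j) = κ z * (r z i : ℂ) := by
    intro i
    filter_upwards [hμ] with z hz
    have he : (Real.exp (2 * v z i₀) : ℂ) ≠ 0 := by exact_mod_cast (Real.exp_pos _).ne'
    rw [hz i]
    simp only [κ, r, Complex.ofReal_mul]
    field_simp
  have hQκ : ∀ i, Tendsto (fun z => κ z * (r z i : ℂ)) 𝒰 (𝓝 (Q i)) := fun i =>
    (hQ i).congr' (hκ i)
  have hN₀' : (N i₀ : ℂ) ≠ 0 := by exact_mod_cast hN₀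
  have hκlim : Tendsto κ 𝒰 (𝓝 (Q i₀ / N i₀)) := by
    refine ((hQκ i₀).div (hr i₀) hN₀').congr' ?_
    filter_upwards [(hr i₀).eventually_ne hN₀'] with z hz
    exact mul_div_cancel_right₀ _ hz
  have hQN : ∀ i, Q i = Q i₀ / N i₀ * N i := fun i =>
    tendsto_nhds_unique (hQκ i) (hκlim.mul (hr i))
  obtain ⟨z, hz1, hz2⟩ : ∃ z, (∀ i, 0 < v z i) ∧
      ∀ α ∈ A, α ∉ F → expWeight α₀ (v z) < expWeight α (v z) := by
    refine ((eventually_all.mpr hv).and ((Finset.eventually_all A).mpr fun α hα => ?_)).exists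
    by_cases h : α ∈ F
    · exact Eventually.of_forall fun z h' => absurd h h'
    · exact (hF' α hα h).mono fun z hz _ => hz
  have hmem : ∀ α ∈ A, (expWeight α (v z) = expWeight α₀ (v z) ↔ α ∈ F) := fun α hα =>
    ⟨fun h => by_contra fun h' => (hz2 α hα h').ne' h, fun h => hF α hα h z⟩
  have hsum : ∀ d : (Fin n →₀ ℕ) → ℂ,
      ∑ α ∈ A with expWeight α (v z) = expWeight α₀ (v z), d α * ∏ i, b i ^ α i =
        ∑ α ∈ A, d α * m α := by
    intro d
    rw [Finset.sum_filter]
    refine Finset.sum_congr rfl fun α hα => ?_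
    by_cases h : α ∈ F
    · rw [if_pos ((hmem α hα).mpr h)]
      simp only [m, Set.indicator_of_mem h]
    · rw [if_neg (mt (hmem α hα).mp h)]
      simp only [m, Set.indicator_of_notMem h, mul_zero]
  have heuler : ∑ i, (v z i : ℂ) * Q i = 0 := by
    have h2 : ∑ i, (v z i : ℂ) * Q i = ∑ α ∈ A, c' α * ((expWeight α (v z) : ℂ) * m α) := by
      simp only [Q, Finset.mul_sum]
      rw [Finset.sum_comm]
      refine Finset.sum_congr rfl fun α _ => ?_
      rw [expWeight_apply]
      push_cast
      rw [Finset.sum_mul, Finset.mul_sum]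
      exact Finset.sum_congr rfl fun i _ => by ring
    have h3 : ∑ α ∈ A, c' α * ((expWeight α (v z) : ℂ) * m α) =
        (expWeight α₀ (v z) : ℂ) * ∑ α ∈ A, c' α * m α := by
      rw [Finset.mul_sum]
      refine Finset.sum_congr rfl fun α hα => ?_
      by_cases h : α ∈ F
      · rw [(hmem α hα).mpr h]; ring
      · simp only [m, Set.indicator_of_notMem h, mul_zero]
    rw [h2, h3, hP, mul_zero]
  have hQ₀ : Q i₀ / N i₀ = 0 := by
    have h2 : ∑ i, (v z i : ℂ) * Q i = Q i₀ / N i₀ * ((v z i₀ * ∑ i, N i : ℝ) : ℂ) := by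
      push_cast
      rw [Finset.mul_sum, Finset.mul_sum]
      refine Finset.sum_congr rfl fun i _ => ?_
      rw [hQN i]
      by_cases h : i ∈ J
      · rw [hJ i h z]; ring
      · simp only [N, Set.indicator_of_notMem h, Complex.ofReal_zero, mul_zero]
    rw [heuler] at h2
    refine (mul_eq_zero.mp h2.symm).resolve_right ?_
    have h3 : 0 < ∑ i, N i := by
      have hnn : ∀ i, 0 ≤ N i := fun i => Set.indicator_nonneg (fun i _ => by positivity) i
      exact (lt_of_le_of_ne (hnn i₀) hN₀.symm).trans_le
        (Finset.single_le_sum (f := N) (fun i _ => hnn i) (Finset.mem_univ i₀))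
    exact_mod_cast (mul_pos (hz1 i₀) h3).ne'
  refine ⟨v z, α₀, b, hz1, hα₀, fun α hα => ?_, hb, ?_, fun i => ?_⟩
  · by_cases h : α ∈ F
    · exact ((hmem α hα).mpr h).ge
    · exact (hz2 α hα h).le
  · rw [hsum, hP]
  · have h2 := hsum fun α => c' α * (α i : ℂ)
    simp only [mul_assoc] at h2
    rw [h2]
    change Q i = 0
    rw [hQN i, hQ₀, zero_mul]

theorem le_of_mem_newtonRegion {n : ℕ} {s : Set (Fin n →₀ ℕ)} {w : Fin n → ℝ} (hw : ∀ i, 0 ≤ w i)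
    {d : ℝ} (hd : ∀ α ∈ s, d ≤ expWeight α w) {z : Fin n → ℝ} (hz : z ∈ newtonRegion s) :
    d ≤ ∑ i, z i * w i := by
  let L : (Fin n → ℝ) →ₗ[ℝ] ℝ := ∑ i, w i • (LinearMap.proj i : (Fin n → ℝ) →ₗ[ℝ] ℝ)
  have hL : ∀ z, L z = ∑ i, z i * w i := fun z => by
    simp [L, mul_comm]
  have hsub : newtonRegion s ⊆ {z | d ≤ L z} := by
    refine convexHull_min ?_ (convex_halfSpace_ge L.isLinear d)
    rintro _ ⟨α, hα, r, hr, rfl⟩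
    change d ≤ L (expR α + r)
    rw [map_add, hL, hL]
    have h1 : 0 ≤ ∑ i, r i * w i := Finset.sum_nonneg fun i _ => mul_nonneg (hr i) (hw i)
    have h2 := hd α hα
    rw [expWeight_apply] at h2
    exact h2.trans (le_add_of_nonneg_right h1)
  rw [← hL]
  exact hsub hz

theorem expR_mem_newtonRegion {n : ℕ} {s : Set (Fin n →₀ ℕ)} {α : Fin n →₀ ℕ} (hα : α ∈ s) :
    expR α ∈ newtonRegion s :=
  subset_convexHull ℝ _ ⟨α, hα, 0, fun _ => le_rfl, (add_zero _).symm⟩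

/-- The face of the Newton region on which a positive weight is minimal. -/
theorem minFace_properties {n : ℕ} {s : Set (Fin n →₀ ℕ)} {w : Fin n → ℝ} (hw : ∀ i, 0 < w i)
    {α₀ : Fin n →₀ ℕ} (hα₀ : α₀ ∈ s) (hmin : ∀ α ∈ s, expWeight α₀ w ≤ expWeight α w) :
    ∃ F : Set (Fin n → ℝ), F.Nonempty ∧ IsExposed ℝ (newtonRegion s) F ∧
      Bornology.IsBounded F ∧ ∀ α ∈ s, (expR α ∈ F ↔ expWeight α w = expWeight α₀ w) := by
  have hge : ∀ z ∈ newtonRegion s, expWeight α₀ w ≤ ∑ i, z i * w i := fun z hz =>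
    le_of_mem_newtonRegion (fun i => (hw i).le) hmin hz
  have hmem : ∀ α ∈ s, (expR α ∈ {z ∈ newtonRegion s | ∑ i, z i * w i = expWeight α₀ w} ↔
      expWeight α w = expWeight α₀ w) := by
    intro α hα
    rw [expWeight_apply α]
    exact ⟨fun h => h.2, fun h => ⟨expR_mem_newtonRegion hα, h⟩⟩
  have hα₀F := (hmem α₀ hα₀).mpr rfl
  refine ⟨{z ∈ newtonRegion s | ∑ i, z i * w i = expWeight α₀ w}, ⟨_, hα₀F⟩, fun _ => ?_, ?_, hmem⟩
  · let L : (Fin n → ℝ) →ₗ[ℝ] ℝ := ∑ i, w i • (LinearMap.proj i : (Fin n → ℝ) →ₗ[ℝ] ℝ)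
    have hL : ∀ z, LinearMap.toContinuousLinearMap L z = ∑ i, z i * w i := fun z => by
      simp [L, mul_comm]
    refine ⟨-LinearMap.toContinuousLinearMap L, ?_⟩
    ext z
    simp only [Set.mem_sep_iff, neg_apply, hL, neg_le_neg_iff]
    refine and_congr_right fun hz => ⟨fun h y hy => h.trans_le (hge y hy), fun h => ?_⟩
    exact le_antisymm ((h _ hα₀F.1).trans_eq hα₀F.2) (hge z hz)
  · refine (Metric.isBounded_Icc (0 : Fin n → ℝ) (fun i => expWeight α₀ w / w i)).subset ?_
    rintro z ⟨hz, hzw⟩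
    have hz0 : ∀ i, 0 ≤ z i := by
      intro i
      have := le_of_mem_newtonRegion (w := Pi.single i 1) (d := 0)
        (fun j => by by_cases h : j = i <;> simp [h])
        (fun α _ => by
          rw [expWeight_apply]
          exact Finset.sum_nonneg fun j _ => mul_nonneg (Nat.cast_nonneg _)
            (by by_cases h : j = i <;> simp [h])) hz
      simpa [Pi.single_apply] using this
    refine ⟨hz0, fun i => ?_⟩
    rw [le_div_iff₀ (hw i), ← hzw]
    exact Finset.single_le_sum (f := fun i => z i * w i)
      (fun j _ => mul_nonneg (hz0 j) (hw j).le) (Finset.mem_univ i)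

theorem Convenient.exists_single_mem_support {n : ℕ} {f : MvPolynomial (Fin n) ℂ}
    (hf : Convenient f) (i : Fin n) : ∃ m : ℕ, Finsupp.single i m ∈ f.support := by
  by_contra! h
  obtain ⟨t, -, ht⟩ := hf i
  have h1 := le_of_mem_newtonRegion (w := fun j => if j = i then 0 else 1) (d := 1)
    (fun j => by split_ifs <;> norm_num) (fun α hα => by
      obtain ⟨j, hji, hj⟩ : ∃ j, j ≠ i ∧ α j ≠ 0 := by
        by_contra! h'
        refine h (α i) ?_
        have : Finsupp.single i (α i) = α := by
          ext j
          by_cases hj : j = i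
          · rw [hj, Finsupp.single_eq_same]
          · rw [Finsupp.single_eq_of_ne hj, h' j hj]
        rw [this]
        exact hα
      rw [expWeight_apply]
      refine le_trans ?_ (Finset.single_le_sum (f := fun j => (α j : ℝ) * if j = i then 0 else 1)
        (fun k _ => by split_ifs <;> simp) (Finset.mem_univ j))
      simp only [if_neg hji, mul_one]
      exact_mod_cast Nat.one_le_iff_ne_zero.mpr hj) ht
  have h2 : ∑ j, (Pi.single i t : Fin n → ℝ) j * (if j = i then 0 else 1) = 0 :=
    Finset.sum_eq_zero fun j _ => by
      by_cases hj : j = i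
      · simp [hj]
      · simp [Pi.single_eq_of_ne hj]
  rw [h2] at h1
  exact absurd h1 (by norm_num)

theorem eval_eq_sum_of_support_subset {n : ℕ} {p : MvPolynomial (Fin n) ℂ}
    {A : Finset (Fin n →₀ ℕ)} (hp : p.support ⊆ A) (x : Fin n → ℂ) :
    eval x p = ∑ α ∈ A, p.coeff α * ∏ i, x i ^ α i := by
  rw [eval_eq']
  exact Finset.sum_subset hp fun α _ hα => by rw [notMem_support_iff.mp hα, zero_mul]

theorem mul_eval_pderiv_eq_sum {n : ℕ} {p : MvPolynomial (Fin n) ℂ}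
    {A : Finset (Fin n →₀ ℕ)} (hp : p.support ⊆ A) (x : Fin n → ℂ) (i : Fin n) :
    x i * eval x (pderiv i p) = ∑ α ∈ A, p.coeff α * ((α i : ℂ) * ∏ j, x j ^ α j) := by
  have h1 : x i * eval x (pderiv i p) =
      ∑ α ∈ p.support, p.coeff α * ((α i : ℂ) * ∏ j, x j ^ α j) := by
    conv_lhs => rw [← support_sum_monomial_coeff p]
    rw [map_sum, map_sum, Finset.mul_sum]
    refine Finset.sum_congr rfl fun α _ => ?_
    have hX : x i = eval x (X i) := (eval_X i).symm
    rw [hX, ← map_mul, X_mul_pderiv_monomial, map_nsmul,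
      eval_monomial, Finsupp.prod_fintype _ _ fun i => pow_zero _, nsmul_eq_mul]
    ring
  rw [h1]
  exact Finset.sum_subset hp fun α _ hα => by rw [notMem_support_iff.mp hα, zero_mul]

theorem coeff_perturb {n : ℕ} (f : MvPolynomial (Fin n) ℂ) (S : Finset (Fin n →₀ ℕ))
    (y : {α // α ∈ S} → ℂ) (α : Fin n →₀ ℕ) :
    (perturb f S y).coeff α = f.coeff α + if h : α ∈ S then y ⟨α, h⟩ else 0 := by
  rw [perturb, coeff_add, coeff_sum]
  congr 1
  simp only [coeff_monomial]
  split_ifs with h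
  · rw [Finset.sum_eq_single ⟨α, h⟩]
    · simp
    · intro β _ hβ
      exact if_neg fun h' => hβ (Subtype.ext h')
    · simp
  · exact Finset.sum_eq_zero fun β _ => if_neg fun h' : β.1 = α => h (h' ▸ β.2)

theorem support_perturb_subset {n : ℕ} (f : MvPolynomial (Fin n) ℂ) (S : Finset (Fin n →₀ ℕ))
    (y : {α // α ∈ S} → ℂ) : (perturb f S y).support ⊆ f.support ∪ S := by
  intro α hα
  by_contra h
  rw [Finset.mem_union, not_or] at h
  rw [mem_support_iff, coeff_perturb, dif_neg h.2, notMem_support_iff.mp h.1] at hα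
  exact hα (add_zero 0)

open Classical in
theorem coeff_faceRestrict {n : ℕ} (f : MvPolynomial (Fin n) ℂ) (F : Set (Fin n → ℝ))
    (α : Fin n →₀ ℕ) :
    (faceRestrict f F).coeff α = if expR α ∈ F then f.coeff α else 0 := by
  simp only [faceRestrict, coeff_sum, coeff_monomial, Finset.sum_ite_eq', Finset.mem_filter]
  by_cases hα : α ∈ f.support
  · simp only [hα, true_and]
  · simp only [hα, false_and, notMem_support_iff.mp hα, ite_self]

/-- A member of the parameter set has no initial form with a critical point with value zero in
the torus. -/
theorem not_initial_form_singular {n : ℕ} {f : MvPolynomial (Fin n) ℂ} (hf : f ≠ 0)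
    {S : Finset (Fin n →₀ ℕ)} (hS : ∀ α ∈ S, expR α ∈ NewtonPolyhedron f)
    {y : {α // α ∈ S} → ℂ} (hy : y ∈ Omega f S) {w : Fin n → ℝ} (hw : ∀ i, 0 < w i)
    {α₀ : Fin n →₀ ℕ} (hα₀ : α₀ ∈ f.support ∪ S)
    (hmin : ∀ α ∈ f.support ∪ S, expWeight α₀ w ≤ expWeight α w) {b : Fin n → ℂ}
    (hb : ∀ i, b i ≠ 0)
    (h0 : ∑ α ∈ f.support ∪ S with expWeight α w = expWeight α₀ w,
      (perturb f S y).coeff α * ∏ i, b i ^ α i = 0)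
    (h1 : ∀ i, ∑ α ∈ f.support ∪ S with expWeight α w = expWeight α₀ w,
      (perturb f S y).coeff α * ((α i : ℂ) * ∏ j, b j ^ α j) = 0) : False := by
  classical
  obtain ⟨α₁, hα₁, hmin₁⟩ := Finset.exists_min_image f.support (fun α => expWeight α w)
    (support_nonempty.mpr hf)
  have h01 : expWeight α₁ w = expWeight α₀ w := by
    refine le_antisymm ?_ (hmin α₁ (Finset.mem_union_left _ hα₁))
    rcases Finset.mem_union.mp hα₀ with h | h
    · exact hmin₁ _ h
    · have := le_of_mem_newtonRegion (fun i => (hw i).le) hmin₁ (hS _ h)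
      rwa [expWeight_apply α₀]
  obtain ⟨F₁, hF₁, hF₁e, hF₁b, hF₁m⟩ := minFace_properties hw (s := {α | α ∈ f.support}) hα₁ hmin₁
  have hmem₁ : expR α₁ ∈ NewtonBoundary (perturb f S y) := by
    rw [hy.1]
    exact ⟨F₁, hF₁, hF₁e, hF₁b, (hF₁m α₁ hα₁).mpr rfl⟩
  obtain ⟨F₂, -, hF₂e, -, hF₂⟩ := hmem₁
  have hmem₂ : expR α₁ ∈ newtonRegion {α | α ∈ (perturb f S y).support} := hF₂e.subset hF₂
  have hne : (perturb f S y).support.Nonempty := by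
    by_contra h
    rw [Finset.not_nonempty_iff_eq_empty] at h
    simp [newtonRegion, h] at hmem₂
  obtain ⟨α₂, hα₂, hmin₂⟩ := Finset.exists_min_image _ (fun α => expWeight α w) hne
  have h02 : expWeight α₂ w = expWeight α₀ w := by
    refine le_antisymm ?_ (hmin α₂ (support_perturb_subset f S y hα₂))
    rw [← h01, expWeight_apply α₁]
    exact le_of_mem_newtonRegion (fun i => (hw i).le) hmin₂ hmem₂
  obtain ⟨F, hF, hFe, hFb, hFm⟩ :=
    minFace_properties hw (s := {α | α ∈ (perturb f S y).support}) hα₂ hmin₂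
  rw [h02] at hFm
  let B := {α ∈ f.support ∪ S | expWeight α w = expWeight α₀ w}
  have hcoeff : ∀ α ∈ B, (faceRestrict (perturb f S y) F).coeff α = (perturb f S y).coeff α := by
    intro α hα
    rw [coeff_faceRestrict]
    by_cases hs : α ∈ (perturb f S y).support
    · rw [if_pos ((hFm α hs).mpr (Finset.mem_filter.mp hα).2)]
    · rw [notMem_support_iff.mp hs, ite_self]
  have hsupp : (faceRestrict (perturb f S y) F).support ⊆ B := by
    intro α hα
    rw [mem_support_iff, coeff_faceRestrict, ite_ne_right_iff, ← mem_support_iff] at hα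
    exact Finset.mem_filter.mpr ⟨support_perturb_subset f S y hα.2, (hFm α hα.2).mp hα.1⟩
  refine hy.2 F hF hFe hFb ⟨b, hb, ?_, fun i => ?_⟩
  · rw [eval_eq_sum_of_support_subset hsupp, ← h0]
    exact Finset.sum_congr rfl fun α hα => by rw [hcoeff α hα]
  · refine (mul_eq_zero.mp ?_).resolve_left (hb i)
    rw [mul_eval_pderiv_eq_sum hsupp, ← h1 i]
    exact Finset.sum_congr rfl fun α hα => by rw [hcoeff α hα]

open Filter Topology in
/-- Near the origin, the hypersurfaces with parameter in a compact subset of the parameter set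
are transverse to the spheres centered at the origin, uniformly in the parameter. -/
theorem exists_uniform_transversality {n : ℕ} {f : MvPolynomial (Fin n) ℂ} (hf : f ≠ 0)
    (hconv : Convenient f) {S : Finset (Fin n →₀ ℕ)} (hS : ∀ α ∈ S, expR α ∈ NewtonPolyhedron f)
    {K : Set ({α // α ∈ S} → ℂ)} (hK : IsCompact K) (hKΩ : K ⊆ Omega f S) :
    ∃ ε > 0, ∀ y ∈ K, ∀ x : Fin n → ℂ, x ≠ 0 → ∑ i, ‖x i‖ ^ 2 < ε ^ 2 →
      eval x (perturb f S y) = 0 → ∀ μ : ℂ, ∃ i,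
        eval x (pderiv i (perturb f S y)) ≠ μ * (starRingEnd ℂ) (x i) := by
  by_contra! h
  choose y hyK x hx0 hxε hxf μ hμ using fun z : ℕ => h (1 / ((z : ℝ) + 1)) (by positivity)
  let 𝒰 : Ultrafilter ℕ := Ultrafilter.of atTop
  have hle : (𝒰 : Filter ℕ) ≤ atTop := Ultrafilter.of_le atTop
  have hx : Tendsto x 𝒰 (𝓝 0) := by
    refine tendsto_pi_nhds.mpr fun i => ?_
    refine squeeze_zero_norm (fun z => ?_) (tendsto_one_div_add_atTop_nhds_zero_nat.mono_left hle)
    refine abs_le_of_sq_le_sq' ?_ (by positivity) |>.2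
    exact (Finset.single_le_sum (f := fun i => ‖x z i‖ ^ 2) (fun _ _ => by positivity)
      (Finset.mem_univ i)).trans (hxε z).le
  obtain ⟨y', hy'K, hy'⟩ := hK.ultrafilter_le_nhds (𝒰.map y)
    (le_principal_iff.mpr (mem_map.mpr (Eventually.of_forall hyK)))
  have hy : Tendsto y 𝒰 (𝓝 y') := hy'
  obtain ⟨w, α₀, b, hw, hα₀, hmin, hb, h0, h1⟩ :=
    exists_initial_form_singular 𝒰 hx (Eventually.of_forall hx0) (A := f.support ∪ S)
      (fun i => (hconv.exists_single_mem_support i).imp fun m hm => Finset.mem_union_left _ hm)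
      (c := fun z α => (perturb f S (y z)).coeff α) (c' := fun α => (perturb f S y').coeff α)
      (fun α _ => by
        simp only [coeff_perturb]
        refine tendsto_const_nhds.add ?_
        split_ifs with hα
        · exact tendsto_pi_nhds.mp hy ⟨α, hα⟩
        · exact tendsto_const_nhds)
      (Eventually.of_forall fun z => by
        rw [← eval_eq_sum_of_support_subset (support_perturb_subset f S (y z))]
        exact hxf z)
      (Eventually.of_forall fun z => ⟨μ z, fun i => by
        rw [← mul_eval_pderiv_eq_sum (support_perturb_subset f S (y z)), hμ z i, mul_left_comm,
          Complex.mul_conj, Complex.normSq_eq_norm_sq]⟩)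
  exact not_initial_form_singular hf hS (hKΩ hy'K) hw hα₀ hmin hb h0 h1

theorem hasFDerivAt_eval {n : ℕ} (p : MvPolynomial (Fin n) ℂ) (x : Fin n → ℂ) :
    HasFDerivAt (fun x => eval x p)
      (∑ i, eval x (pderiv i p) • (ContinuousLinearMap.proj i : (Fin n → ℂ) →L[ℂ] ℂ)) x := by
  induction p using MvPolynomial.induction_on with
  | C a =>
    simp only [eval_C]
    refine (hasFDerivAt_const a x).congr_fderiv ?_
    ext v
    simp
  | add p q hp hq =>
    have h := hp.add hq
    rw [← Finset.sum_add_distrib] at h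
    simp only [← add_smul, ← map_add] at h
    refine h.congr_of_eventuallyEq (Filter.Eventually.of_forall fun z => ?_)
    simp
  | mul_X p j hp =>
    have h := hp.mul (ContinuousLinearMap.proj (R := ℂ) (φ := fun _ : Fin n => ℂ) j).hasFDerivAt
    simp only [map_mul, eval_X]
    refine h.congr_fderiv ?_
    ext v
    simp only [pderiv_mul, map_add, map_mul, eval_X, pderiv_X, add_apply, smul_apply,
      sum_apply, ContinuousLinearMap.proj_apply, smul_eq_mul, Finset.mul_sum, add_mul,
      Finset.sum_add_distrib]
    rw [add_comm]
    congr 1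
    · exact Finset.sum_congr rfl fun i _ => by ring
    · rw [Finset.sum_eq_single j]
      · simp
      · intro i _ hi
        simp [hi.symm]
      · simp

theorem eval_perturb {n : ℕ} (f : MvPolynomial (Fin n) ℂ) (S : Finset (Fin n →₀ ℕ))
    (y : {α // α ∈ S} → ℂ) (x : Fin n → ℂ) :
    eval x (perturb f S y) = eval x f + ∑ α ∈ S.attach, y α * eval x (monomial α.1 1) := by
  simp only [perturb, map_add, map_sum, eval_monomial, one_mul]

theorem eval_pderiv_perturb {n : ℕ} (f : MvPolynomial (Fin n) ℂ) (S : Finset (Fin n →₀ ℕ))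
    (y : {α // α ∈ S} → ℂ) (x : Fin n → ℂ) (i : Fin n) :
    eval x (pderiv i (perturb f S y)) =
      eval x (pderiv i f) + ∑ α ∈ S.attach, y α * eval x (pderiv i (monomial α.1 1)) := by
  simp only [perturb, map_add, map_sum, pderiv_monomial, eval_monomial, one_mul, mul_assoc]

theorem contDiff_eval {n : ℕ} (p : MvPolynomial (Fin n) ℂ) :
    ContDiff ℝ 1 fun x : Fin n → ℂ => eval x p := by
  simp only [eval_eq']
  fun_prop

/-- The defining equations of the family of links, with the radius as an additional parameter. -/
def linkMap {n : ℕ} (f : MvPolynomial (Fin n) ℂ) (S : Finset (Fin n →₀ ℕ))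
    (q : (Fin n → ℂ) × (({α // α ∈ S} → ℂ) × ℝ)) : ℝ × ℂ :=
  (∑ i, ‖q.1 i‖ ^ 2 - q.2.2 ^ 2, eval q.1 (perturb f S q.2.1))

/-- The directions spanned by the position vector and the complex gradient. -/
def linkNormal {n : ℕ} (f : MvPolynomial (Fin n) ℂ) (S : Finset (Fin n →₀ ℕ))
    (q : (Fin n → ℂ) × (({α // α ∈ S} → ℂ) × ℝ)) : ℝ × ℂ →L[ℝ] Fin n → ℂ :=
  (ContinuousLinearMap.fst ℝ ℝ ℂ).smulRight q.1 + (ContinuousLinearMap.snd ℝ ℝ ℂ).smulRight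
    fun i => (starRingEnd ℂ) (eval q.1 (pderiv i (perturb f S q.2.1)))

theorem linkNormal_apply {n : ℕ} (f : MvPolynomial (Fin n) ℂ) (S : Finset (Fin n →₀ ℕ))
    (q : (Fin n → ℂ) × (({α // α ∈ S} → ℂ) × ℝ)) (c : ℝ × ℂ) (i : Fin n) :
    linkNormal f S q c i =
      c.1 * q.1 i + c.2 * (starRingEnd ℂ) (eval q.1 (pderiv i (perturb f S q.2.1))) := by
  simp [linkNormal]

theorem contDiff_linkMap {n : ℕ} (f : MvPolynomial (Fin n) ℂ) (S : Finset (Fin n →₀ ℕ)) :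
    ContDiff ℝ 1 (linkMap f S) := by
  have he : ∀ p : MvPolynomial (Fin n) ℂ, ContDiff ℝ 1
      fun q : (Fin n → ℂ) × (({α // α ∈ S} → ℂ) × ℝ) => eval q.1 p := fun p =>
    (contDiff_eval p).comp contDiff_fst
  refine ContDiff.prodMk ?_ ?_
  · refine ContDiff.sub (ContDiff.sum fun i _ => ContDiff.norm_sq ℝ ?_) ?_ <;> fun_prop
  · simp only [eval_perturb]
    refine (he f).add (ContDiff.sum fun α _ => ContDiff.mul ?_ (he _))
    fun_prop

theorem contDiff_linkNormal {n : ℕ} (f : MvPolynomial (Fin n) ℂ) (S : Finset (Fin n →₀ ℕ)) :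
    ContDiff ℝ 1 (linkNormal f S) := by
  have he : ∀ p : MvPolynomial (Fin n) ℂ, ContDiff ℝ 1
      fun q : (Fin n → ℂ) × (({α // α ∈ S} → ℂ) × ℝ) => eval q.1 p := fun p =>
    (contDiff_eval p).comp contDiff_fst
  refine contDiff_clm_apply_iff.mpr fun c => contDiff_pi.mpr fun i => ?_
  simp only [linkNormal_apply, eval_pderiv_perturb]
  refine ContDiff.add ?_ (contDiff_const.mul (Complex.conjCLE.contDiff.comp
    ((he _).add (ContDiff.sum fun α _ => ContDiff.mul ?_ (he _)))))
  · fun_prop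
  · fun_prop

theorem linkMap_eq_zero_iff {n : ℕ} {f : MvPolynomial (Fin n) ℂ} {S : Finset (Fin n →₀ ℕ)}
    {q : (Fin n → ℂ) × (({α // α ∈ S} → ℂ) × ℝ)} :
    linkMap f S q = 0 ↔ ∑ i, ‖q.1 i‖ ^ 2 = q.2.2 ^ 2 ∧ eval q.1 (perturb f S q.2.1) = 0 := by
  rw [linkMap, Prod.mk_eq_zero, sub_eq_zero]

theorem linkMap_fderiv_linkNormal_injective {n : ℕ} {f : MvPolynomial (Fin n) ℂ}
    {S : Finset (Fin n →₀ ℕ)} {x : Fin n → ℂ} {b : ({α // α ∈ S} → ℂ) × ℝ} (hx : x ≠ 0)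
    (htr : ∀ μ : ℂ, ∃ i, eval x (pderiv i (perturb f S b.1)) ≠ μ * (starRingEnd ℂ) (x i))
    {c : ℝ × ℂ} (hc : fderiv ℝ (fun x => linkMap f S (x, b)) x (linkNormal f S (x, b) c) = 0) :
    c = 0 := by
  obtain ⟨s, t⟩ := c
  let D : Fin n → ℂ := fun i => eval x (pderiv i (perturb f S b.1))
  set v := linkNormal f S (x, b) (s, t) with hv
  have hvi : ∀ i, v i = s * x i + t * (starRingEnd ℂ) (D i) := fun i => linkNormal_apply f S _ _ i
  have hd1 : HasFDerivAt (fun x : Fin n → ℂ => ∑ i, ‖x i‖ ^ 2 - b.2 ^ 2)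
      (∑ i, 2 • (innerSL ℝ (x i)).comp
        (ContinuousLinearMap.proj i : (Fin n → ℂ) →L[ℝ] ℂ)) x :=
    (HasFDerivAt.fun_sum fun i _ =>
      (ContinuousLinearMap.proj i : (Fin n → ℂ) →L[ℝ] ℂ).hasFDerivAt.norm_sq).sub_const _
  have hd2 := (hasFDerivAt_eval (perturb f S b.1) x).restrictScalars ℝ
  have hd : HasFDerivAt (fun x => linkMap f S (x, b)) _ x := hd1.prodMk hd2
  rw [hd.fderiv, ContinuousLinearMap.prod_apply, Prod.mk_eq_zero] at hc
  obtain ⟨hc1, hc2⟩ := hc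
  have hc1' : ∑ i, (v i * (starRingEnd ℂ) (x i)).re = 0 := by
    have h : ∑ i, 2 * (v i * (starRingEnd ℂ) (x i)).re = 0 := by
      simpa [Complex.inner, mul_add] using hc1
    rw [← Finset.mul_sum] at h
    linarith
  have hc2' : ∑ i, D i * v i = 0 := by
    simpa using hc2
  have hnorm : ∑ i, ‖v i‖ ^ 2 = 0 := by
    have h1 : ∀ i, ‖v i‖ ^ 2 = s * (v i * (starRingEnd ℂ) (x i)).re +
        ((starRingEnd ℂ) t * (D i * v i)).re := by
      intro i
      have h2 : ((‖v i‖ ^ 2 : ℝ) : ℂ) = s * (v i * (starRingEnd ℂ) (x i)) +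
          (starRingEnd ℂ) t * (D i * v i) := by
        rw [← Complex.normSq_eq_norm_sq, ← Complex.mul_conj]
        conv_lhs => rw [hvi i, ← hvi i]
        have h3 : (starRingEnd ℂ) (v i) = s * (starRingEnd ℂ) (x i) + (starRingEnd ℂ) t * D i := by
          rw [hvi i]
          simp
        rw [h3]
        ring
      have h4 := congrArg Complex.re h2
      rwa [Complex.ofReal_re, Complex.add_re, Complex.re_ofReal_mul] at h4
    simp only [h1]
    rw [Finset.sum_add_distrib, ← Finset.mul_sum, hc1', ← Complex.re_sum, ← Finset.mul_sum, hc2']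
    simp
  have hv0 : ∀ i, s * x i + t * (starRingEnd ℂ) (D i) = 0 := by
    intro i
    have := (Finset.sum_eq_zero_iff_of_nonneg fun i _ => by positivity).mp hnorm i
      (Finset.mem_univ i)
    rw [← hvi i]
    simpa using this
  have ht : t = 0 := by
    by_contra ht
    obtain ⟨i, hi⟩ := htr (-s / (starRingEnd ℂ) t)
    refine hi ?_
    have h1 := congrArg (starRingEnd ℂ) (hv0 i)
    simp only [map_add, map_mul, Complex.conj_ofReal, Complex.conj_conj, map_zero] at h1
    have h2 : (starRingEnd ℂ) t ≠ 0 := by simpa using ht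
    change D i = _
    field_simp
    linear_combination h1
  obtain ⟨i, hi⟩ := Function.ne_iff.mp hx
  have hs := hv0 i
  rw [ht, zero_mul, add_zero, mul_eq_zero] at hs
  have hs' : s = 0 := by exact_mod_cast hs.resolve_right hi
  rw [hs', ht, Prod.mk_zero_zero]

theorem pos_of_sum_norm_sq {n : ℕ} {x : Fin n → ℂ} (hx : x ≠ 0) : 0 < ∑ i, ‖x i‖ ^ 2 := by
  obtain ⟨i, hi⟩ := Function.ne_iff.mp hx
  have h : 0 < ‖x i‖ := norm_pos_iff.mpr hi
  exact (pow_pos h 2).trans_le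
    (Finset.single_le_sum (f := fun i => ‖x i‖ ^ 2) (fun _ _ => by positivity) (Finset.mem_univ i))

/-- The total space of the family of links of radius less than `ρ` over a contractible base is
homotopy equivalent to each link. -/
theorem homotopyEquiv_link {n : ℕ} {f : MvPolynomial (Fin n) ℂ} {S : Finset (Fin n →₀ ℕ)}
    {U : Set ({α // α ∈ S} → ℂ)} [ContractibleSpace U] {ε : ℝ}
    (htr : ∀ y ∈ U, ∀ x : Fin n → ℂ, x ≠ 0 → ∑ i, ‖x i‖ ^ 2 < ε ^ 2 →
      eval x (perturb f S y) = 0 → ∀ μ : ℂ, ∃ i,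
        eval x (pderiv i (perturb f S y)) ≠ μ * (starRingEnd ℂ) (x i))
    {ρ : ℝ} (hρ : ρ ≤ ε) {y : {α // α ∈ S} → ℂ} (hy : y ∈ U) {r : ℝ} (hr : r ∈ Set.Ioo 0 ρ) :
    Nonempty (ContinuousMap.HomotopyEquiv
      {q : (Fin n → ℂ) × (({α // α ∈ S} → ℂ) × ℝ) |
        q.2 ∈ U ×ˢ Set.Ioo 0 ρ ∧ linkMap f S q = 0}
      {x : Fin n → ℂ | linkMap f S (x, (y, r)) = 0}) := by
  have : ContractibleSpace (Set.Ioo 0 ρ) :=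
    (convex_Ioo 0 ρ).contractibleSpace ⟨r, hr⟩
  have : ContractibleSpace (U ×ˢ Set.Ioo 0 ρ : Set (({α // α ∈ S} → ℂ) × ℝ)) :=
    (Homeomorph.Set.prod U (Set.Ioo 0 ρ)).contractibleSpace
  refine homotopyEquiv_zeroSet_fiber (contDiff_linkMap f S) (contDiff_linkNormal f S) (R := ε)
    ?_ ?_ (b₀ := (y, r)) ⟨hy, hr⟩
  · intro x b hb hg
    have h1 := (linkMap_eq_zero_iff.mp hg).1
    have hbρ : b.2 < ρ := hb.2.2
    have hb0 : 0 < b.2 := hb.2.1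
    refine (pi_norm_le_iff_of_nonneg (by linarith)).mpr fun i => ?_
    refine le_trans ?_ (hbρ.le.trans hρ)
    refine (abs_le_of_sq_le_sq' ?_ hb0.le).2
    rw [← h1]
    exact Finset.single_le_sum (f := fun i => ‖x i‖ ^ 2) (fun _ _ => by positivity)
      (Finset.mem_univ i)
  · intro x b hb hg c hc
    obtain ⟨h1, h2⟩ := linkMap_eq_zero_iff.mp hg
    have hbρ : b.2 < ρ := hb.2.2
    have hb0 : 0 < b.2 := hb.2.1
    have hx : x ≠ 0 := by
      rintro rfl
      simp at h1
      exact (pow_pos hb0 2).ne h1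
    refine linkMap_fderiv_linkNormal_injective hx (htr b.1 hb.1 x hx ?_ h2) hc
    rw [h1]
    exact pow_lt_pow_left₀ (hbρ.trans_le hρ) hb0.le two_ne_zero

/-- Recording the norm identifies the punctured total space with the family of links. -/
def vtildeHomeomorph {n : ℕ} (f : MvPolynomial (Fin n) ℂ) (S : Finset (Fin n →₀ ℕ))
    (U : Set ({α // α ∈ S} → ℂ)) {ε : ℝ} (hε : 0 < ε) :
    ↥(Vtilde f S ∩ ((eBall n ε \ {0}) ×ˢ U)) ≃ₜ
      {q : (Fin n → ℂ) × (({α // α ∈ S} → ℂ) × ℝ) |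
        q.2 ∈ U ×ˢ Set.Ioo 0 ε ∧ linkMap f S q = 0} where
  toFun p := ⟨(p.1.1, (p.1.2, √(∑ i, ‖p.1.1 i‖ ^ 2))),
    ⟨p.2.2.2, Real.sqrt_pos.mpr (pos_of_sum_norm_sq p.2.2.1.2),
      (Real.sqrt_lt' hε).mpr p.2.2.1.1⟩,
    linkMap_eq_zero_iff.mpr ⟨(Real.sq_sqrt (pos_of_sum_norm_sq p.2.2.1.2).le).symm, p.2.1⟩⟩
  invFun q := ⟨(q.1.1, q.1.2.1), (linkMap_eq_zero_iff.mp q.2.2).2,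
    ⟨by
      change ∑ i, ‖q.1.1 i‖ ^ 2 < ε ^ 2
      rw [(linkMap_eq_zero_iff.mp q.2.2).1]
      exact pow_lt_pow_left₀ q.2.1.2.2 q.2.1.2.1.le two_ne_zero, by
      intro h
      have h1 := (linkMap_eq_zero_iff.mp q.2.2).1
      rw [Set.mem_singleton_iff.mp h] at h1
      simp at h1
      exact (pow_pos q.2.1.2.1 2).ne h1⟩, q.2.1.1⟩
  left_inv p := rfl
  right_inv q := by
    refine Subtype.ext (Prod.ext rfl (Prod.ext rfl ?_))
    change √(∑ i, ‖q.1.1 i‖ ^ 2) = q.1.2.2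
    rw [(linkMap_eq_zero_iff.mp q.2.2).1, Real.sqrt_sq q.2.1.2.1.le]
  continuous_toFun := by fun_prop
  continuous_invFun := by fun_prop

/-- Lemma 5.3 (cone lemma), second part: for relatively compact, contractible open
`U ⊆ Ω`, all sufficiently small `ε > 0` and every `y ∈ U`, the space
`Ṽ ∩ ((B(0,ε) ∖ {0}) × U)` is homotopy equivalent to `V_y ∩ S(0,ε)`. -/
theorem stmt3 (n : ℕ) (hn : 2 ≤ n) (f : MvPolynomial (Fin n) ℂ)
    (hfnc : ¬ ∃ c : ℂ, f = C c) (hf0 : eval (0 : Fin n → ℂ) f = 0)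
    (hconv : Convenient f) (hnd : NondegAtZero f)
    (hsing : IsSingularPt f 0)
    (hiso : ∃ U : Set (Fin n → ℂ), IsOpen U ∧ (0 : Fin n → ℂ) ∈ U ∧
      ∀ x ∈ U, x ≠ 0 → ¬ IsSingularPt f x)
    (P : Set (Fin n → ℝ)) (hPpoly : ∃ T : Finset (Fin n → ℝ), P = convexHull ℝ ↑T)
    (hPsub : P ⊆ NewtonPolyhedron f)
    (S : Finset (Fin n →₀ ℕ)) (hS : ∀ α : Fin n →₀ ℕ, α ∈ S ↔ expR α ∈ P)
    (hPface : boundedFacesUnion (newtonRegion {α | α ∈ S}) = NewtonBoundary f)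
    (U : Set ({α // α ∈ S} → ℂ)) (hUopen : IsOpen U) (hUsub : U ⊆ Omega f S)
    (hUcpt : IsCompact (closure U)) (hUcl : closure U ⊆ Omega f S)
    (hUcontr : ContractibleSpace ↥U) :
    ∃ ε₀ : ℝ, 0 < ε₀ ∧ ∀ ε : ℝ, 0 < ε → ε ≤ ε₀ → ∀ y ∈ U,
      Nonempty (ContinuousMap.HomotopyEquiv
        ↥(Vtilde f S ∩ ((eBall n ε \ {0}) ×ˢ U))
        ↥({x : Fin n → ℂ | eval x (perturb f S y) = 0} ∩ eSphere n ε)) := by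
  have hf : f ≠ 0 := by
    rintro rfl
    exact hfnc ⟨0, C_0.symm⟩
  obtain ⟨ε₁, hε₁, htr⟩ := exists_uniform_transversality hf hconv
    (fun α hα => hPsub ((hS α).mp hα)) hUcpt hUcl
  have htrU := fun y (hy : y ∈ U) => htr y (subset_closure hy)
  refine ⟨ε₁ / 2, by linarith, fun ε hε hεle y hy => ?_⟩
  obtain ⟨e₁⟩ := homotopyEquiv_link htrU (ρ := ε) (by linarith) hy (r := ε / 2)
    ⟨by linarith, by linarith⟩
  obtain ⟨e₂⟩ := homotopyEquiv_link htrU (ρ := ε₁) le_rfl hy (r := ε / 2)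
    ⟨by linarith, by linarith⟩
  obtain ⟨e₃⟩ := homotopyEquiv_link htrU (ρ := ε₁) le_rfl hy (r := ε) ⟨hε, by linarith⟩
  have hfib : {x : Fin n → ℂ | linkMap f S (x, (y, ε)) = 0} =
      {x : Fin n → ℂ | eval x (perturb f S y) = 0} ∩ eSphere n ε := by
    ext x
    exact linkMap_eq_zero_iff.trans and_comm
  exact ⟨(((vtildeHomeomorph f S U hε).toHomotopyEquiv.trans e₁).trans e₂.symm).trans
    (e₃.trans (Homeomorph.setCongr hfib).toHomotopyEquiv)⟩
end
end

section
/- Let V be a finite-dimensional vector space over ℂ, let N : V → V be a nilpotent linear endomorphism, let r ∈ ℤ, and let M = (M_q)_{q∈ℤ} be an increasing filtration of V by linear subspaces (M_q ⊆ M_{q+1} for all q) with M_q = 0 for q sufficiently small and M_q = V for q sufficiently large, such that N(M_q) ⊆ M_{q−2} for all q, and such that for every integer l ≥ 0 the map induced by N^l from the graded piece Gr^M_{r+l} V = M_{r+l}/M_{r+l−1} to the graded piece Gr^M_{r−l} V = M_{r−l}/M_{r−l−1} is an isomorphism. Then for every integer s ≥ 1, the number of Jordan blocks of N of size s, namely dim_ℂ(ker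 N ∩ range N^{s−1}) − dim_ℂ(ker N ∩ range N^{s}), equals dim_ℂ Gr^M_{r+1−s} V − dim_ℂ Gr^M_{r−1−s} V. -/
section MonodromyFiltration

variable {K V : Type*} [Field K] [AddCommGroup V] [Module K V]
  {N : Module.End K V} {r : ℤ} {M : ℤ → Submodule K V}

theorem pow_apply_mem_filtration (hNM : ∀ q : ℤ, ∀ x ∈ M q, N x ∈ M (q - 2))
    (k : ℕ) {q : ℤ} {x : V} (hx : x ∈ M q) : (N ^ k) x ∈ M (q - 2 * k) := by
  induction k with
  | zero => simpa using hx
  | succ k ih =>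
    rw [pow_succ', Module.End.mul_apply]
    convert hNM _ _ ih using 2
    push_cast
    ring

/-- In the lower half of the filtration, every element of `M (r - l)` is the image under `N ^ l`
of an element of `M (r + l)`. -/
theorem exists_pow_apply_eq_of_mem_filtration
    (hmono : Monotone M) (hbot : ∃ a : ℤ, ∀ q : ℤ, q ≤ a → M q = ⊥)
    (hNM : ∀ q : ℤ, ∀ x ∈ M q, N x ∈ M (q - 2))
    (hsurj : ∀ l : ℕ, ∀ y ∈ M (r - l),
      ∃ x ∈ M (r + l), (N ^ l) x - y ∈ M (r - l - 1))
    (l : ℕ) {y : V} (hy : y ∈ M (r - l)) : ∃ x ∈ M (r + l), (N ^ l) x = y := by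
  obtain ⟨a, ha⟩ := hbot
  obtain ⟨n, hn⟩ : ∃ n : ℕ, r - l - n ≤ a := ⟨(r - l - a).toNat, by omega⟩
  induction n generalizing l y with
  | zero =>
    rw [ha _ (by simpa using hn), Submodule.mem_bot] at hy
    exact ⟨0, zero_mem _, by simp [hy]⟩
  | succ n ih =>
    obtain ⟨x, hx, hxy⟩ := hsurj l y hy
    obtain ⟨z, hz, hzy⟩ := ih (l + 1) (y := (N ^ l) x - y)
      (by convert hxy using 2; push_cast; ring) (by push_cast at hn ⊢; linarith)
    refine ⟨x - N z, sub_mem hx (hmono ?_ (hNM _ z hz)), ?_⟩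
    · push_cast
      linarith
    · rw [pow_succ, Module.End.mul_apply] at hzy
      rw [map_sub, hzy, sub_sub_cancel]

theorem mem_filtration_of_pow_succ_apply_eq_zero
    (htop : ∃ b : ℤ, ∀ q : ℤ, b ≤ q → M q = ⊤)
    (hinj : ∀ l : ℕ, ∀ x ∈ M (r + l),
      (N ^ l) x ∈ M (r - l - 1) → x ∈ M (r + l - 1))
    (l : ℕ) {x : V} (hx : (N ^ (l + 1)) x = 0) : x ∈ M (r + l) := by
  obtain ⟨b, hb⟩ := htop
  obtain ⟨n, hn⟩ : ∃ n : ℕ, b ≤ r + l + n := ⟨(b - r - l).toNat, by omega⟩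
  induction n generalizing l with
  | zero => simp [hb _ (show b ≤ r + l by simpa using hn)]
  | succ n ih =>
    have hx' := ih (l + 1) (by rw [pow_succ', Module.End.mul_apply, hx, map_zero])
      (by push_cast at hn ⊢; linarith)
    have := hinj (l + 1) x hx' (hx ▸ zero_mem _)
    convert this using 2
    push_cast
    ring

theorem ker_inf_range_pow_eq_ker_inf_filtration
    (hmono : Monotone M) (hbot : ∃ a : ℤ, ∀ q : ℤ, q ≤ a → M q = ⊥)
    (htop : ∃ b : ℤ, ∀ q : ℤ, b ≤ q → M q = ⊤)
    (hNM : ∀ q : ℤ, ∀ x ∈ M q, N x ∈ M (q - 2))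
    (hinj : ∀ l : ℕ, ∀ x ∈ M (r + l),
      (N ^ l) x ∈ M (r - l - 1) → x ∈ M (r + l - 1))
    (hsurj : ∀ l : ℕ, ∀ y ∈ M (r - l),
      ∃ x ∈ M (r + l), (N ^ l) x - y ∈ M (r - l - 1))
    (l : ℕ) :
    LinearMap.ker N ⊓ LinearMap.range (N ^ l) = LinearMap.ker N ⊓ M (r - l) := by
  apply le_antisymm
  · rintro _ ⟨hy, x, rfl⟩
    refine ⟨hy, ?_⟩
    have hx := mem_filtration_of_pow_succ_apply_eq_zero htop hinj l (x := x)
      (by rw [pow_succ', Module.End.mul_apply]; exact hy)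
    rw [SetLike.mem_coe]
    convert pow_apply_mem_filtration hNM l hx using 2
    ring
  · rintro y ⟨hy, hyM⟩
    obtain ⟨x, -, hx⟩ := exists_pow_apply_eq_of_mem_filtration hmono hbot hNM hsurj l hyM
    exact ⟨hy, x, hx⟩

theorem map_filtration_eq
    (hmono : Monotone M) (hbot : ∃ a : ℤ, ∀ q : ℤ, q ≤ a → M q = ⊥)
    (hNM : ∀ q : ℤ, ∀ x ∈ M q, N x ∈ M (q - 2))
    (hsurj : ∀ l : ℕ, ∀ y ∈ M (r - l),
      ∃ x ∈ M (r + l), (N ^ l) x - y ∈ M (r - l - 1))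
    (l : ℕ) : (M (r - l + 1)).map N = M (r - l - 1) := by
  apply le_antisymm
  · rintro _ ⟨x, hx, rfl⟩
    convert hNM _ x hx using 2
    ring
  · intro y hy
    obtain ⟨x, hx, rfl⟩ := exists_pow_apply_eq_of_mem_filtration hmono hbot hNM hsurj (l + 1)
      (y := y) (by convert hy using 2; push_cast; ring)
    refine ⟨(N ^ l) x, ?_, by rw [pow_succ', Module.End.mul_apply]⟩
    rw [SetLike.mem_coe]
    convert pow_apply_mem_filtration hNM l hx using 2
    push_cast
    ring

theorem finrank_map_add_finrank_ker_inf [FiniteDimensional K V] (N : Module.End K V)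
    (W : Submodule K V) :
    Module.finrank K (W.map N) + Module.finrank K ↥(LinearMap.ker N ⊓ W) =
      Module.finrank K W := by
  have h := (N.domRestrict W).finrank_range_add_finrank_ker
  rwa [LinearMap.range_domRestrict, LinearMap.ker_domRestrict,
    (W.equivSubtypeMap _).finrank_eq, Submodule.map_comap_subtype, inf_comm] at h

end MonodromyFiltration


/-- Let `N` be a nilpotent endomorphism of a finite-dimensional `ℂ`-vector space `V`,
and let `M` be an exhaustive increasing filtration of `V` with `N (M q) ⊆ M (q - 2)`
such that, for every `l ≥ 0`, `N^l` induces an isomorphism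
`Gr^M_{r+l} V ≃ Gr^M_{r-l} V` (injectivity and surjectivity of the induced map are
spelled out on representatives).  Then for every `s ≥ 1` the number of Jordan blocks
of `N` of size `s`, namely
`dim (ker N ⊓ range N^{s-1}) − dim (ker N ⊓ range N^s)`,
equals `dim Gr^M_{r+1-s} V − dim Gr^M_{r-1-s} V` (graded pieces computed as
differences of dimensions of the filtration steps). -/
theorem stmt7 (V : Type*) [AddCommGroup V] [Module ℂ V] [FiniteDimensional ℂ V]
    (N : Module.End ℂ V) (hN : IsNilpotent N) (r : ℤ)
    (M : ℤ → Submodule ℂ V)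
    (hmono : ∀ q : ℤ, M q ≤ M (q + 1))
    (hbot : ∃ a : ℤ, ∀ q : ℤ, q ≤ a → M q = ⊥)
    (htop : ∃ b : ℤ, ∀ q : ℤ, b ≤ q → M q = ⊤)
    (hNM : ∀ q : ℤ, ∀ x ∈ M q, N x ∈ M (q - 2))
    (hinj : ∀ l : ℕ, ∀ x ∈ M (r + l),
      (N ^ l) x ∈ M (r - l - 1) → x ∈ M (r + l - 1))
    (hsurj : ∀ l : ℕ, ∀ y ∈ M (r - l),
      ∃ x ∈ M (r + l), (N ^ l) x - y ∈ M (r - l - 1)) :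
    ∀ s : ℕ, 1 ≤ s →
      (Module.finrank ℂ ↥(LinearMap.ker N ⊓ LinearMap.range (N ^ (s - 1))) : ℤ) -
        (Module.finrank ℂ ↥(LinearMap.ker N ⊓ LinearMap.range (N ^ s)) : ℤ) =
      ((Module.finrank ℂ ↥(M (r + 1 - s)) : ℤ) - (Module.finrank ℂ ↥(M (r - s)) : ℤ)) -
        ((Module.finrank ℂ ↥(M (r - 1 - s)) : ℤ) -
          (Module.finrank ℂ ↥(M (r - 2 - s)) : ℤ)) := by
  have hM : Monotone M := monotone_int_of_le_succ hmono
  intro s hs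
  obtain ⟨t, rfl⟩ := Nat.exists_eq_add_of_le' hs
  have hker := ker_inf_range_pow_eq_ker_inf_filtration hM hbot htop hNM hinj hsurj
  rw [Nat.add_sub_cancel, hker, hker]
  have h₁ := finrank_map_add_finrank_ker_inf N (M (r - (t + 1 : ℕ) + 1))
  have h₂ := finrank_map_add_finrank_ker_inf N (M (r - (t + 2 : ℕ) + 1))
  rw [map_filtration_eq hM hbot hNM hsurj,
    show r - ((t + 1 : ℕ) : ℤ) + 1 = r - t by push_cast; ring,
    show r - ((t + 1 : ℕ) : ℤ) - 1 = r - 1 - (t + 1 : ℕ) by ring] at h₁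
  rw [map_filtration_eq hM hbot hNM hsurj,
    show r - ((t + 2 : ℕ) : ℤ) + 1 = r - (t + 1 : ℕ) by push_cast; ring,
    show r - ((t + 2 : ℕ) : ℤ) - 1 = r - 2 - (t + 1 : ℕ) by push_cast; ring] at h₂
  rw [show r + 1 - ((t + 1 : ℕ) : ℤ) = r - t by push_cast; ring]
  omega
end
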